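/- There exists a constant C₁ > 0, depending only on h (and in particular not on δ or x), such that for every δ ∈ (−1,1): Ψ_δ is differentiable at every point of [0,1]² lying neither on the crack 𝔠 nor on the seams S, the Jacobian matrix J_{Ψ_δ} is continuous on [0,1]² ∖ (𝔠 ∪ S), and ‖J_{Ψ_δ}(x) − I‖ ≤ C₁·|δ| for every x ∈ [0,1]² ∖ (𝔠 ∪ S), where ‖·‖ denotes the maximum absolute value of the entries of a 2×2 matrix and I the identity matrix. -/

import Mathlib

open MeasureTheory Set Filter

noncomputable section

/-- The closed unit square `[0,1]²` in the plane `ℝ × ℝ`. -/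
def unitSq : Set (ℝ × ℝ) := Set.Icc (0:ℝ) 1 ×ˢ Set.Icc (0:ℝ) 1

/-- The topological boundary of the unit square. -/
def unitSqBdry : Set (ℝ × ℝ) :=
  {x ∈ unitSq | x.1 = 0 ∨ x.1 = 1 ∨ x.2 = 0 ∨ x.2 = 1}

/-- The domain `[0,1] × [0,1/2) \ {(1/2,0)}` of the parametrisation `K`. -/
def lowerDom : Set (ℝ × ℝ) :=
  (Set.Icc (0:ℝ) 1 ×ˢ Set.Ico (0:ℝ) (1/2)) \ {((1/2 : ℝ), (0 : ℝ))}

/-- The hypotheses on the auxiliary function `h : [0,1/2) → [0,∞)`. -/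
def GoodH (h : ℝ → ℝ) : Prop :=
  (∀ r ∈ Set.Ico (0:ℝ) (1/2), 0 ≤ h r) ∧
  MonotoneOn h (Set.Ico (0:ℝ) (1/2)) ∧
  (∀ r ∈ Set.Icc (0:ℝ) (1/10), h r = 0) ∧
  Filter.Tendsto h (nhdsWithin (1/2 : ℝ) (Set.Iio (1/2 : ℝ))) Filter.atTop ∧
  ContDiffOn ℝ 3 h (Set.Ico (0:ℝ) (1/2)) ∧
  ∃ c : ℝ, ∀ r ∈ Set.Ico (0:ℝ) (1/2),
    (deriv h r) ^ 2 ≤ c * (r + h r) ^ 3 ∧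
    deriv (deriv h) r * deriv h r ≤ c * (r + h r) ^ 3 ∧
    |deriv (deriv (deriv h)) r| ≤ c * (r + h r) ^ 2

/-- The defining property of the angle function `Θ`. -/
def GoodTheta (h : ℝ → ℝ) (r₀ : ℝ) (Θ : ℝ → ℝ) : Prop :=
  (∀ r : ℝ, 0 < r → r ≤ r₀ → Θ r = Real.arccos (h r / (h r + r))) ∧
  (∀ r : ℝ, r₀ < r → r < 1/2 → Θ r = Real.arcsin (1 / (2 * (h r + r))))

/-- The defining property of the `r-θ` parametrisation `K`. -/
def GoodK (h Θ : ℝ → ℝ) (K : ℝ × ℝ → ℝ × ℝ) : Prop :=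
  Set.BijOn K lowerDom (Set.Ioo (0:ℝ) (1/2) ×ˢ Set.Icc (-1:ℝ) 1) ∧
  ∀ x ∈ lowerDom,
    x.1 = 1/2 + ((K x).1 + h (K x).1) * Real.sin ((K x).2 * Θ (K x).1) ∧
    x.2 = ((K x).1 + h (K x).1) * Real.cos ((K x).2 * Θ (K x).1) - h (K x).1

/-- The weight function `w_r(θ) = 1 + h'(r) − h'(r) cos(θ Θ(r))`. -/
def wgt (h Θ : ℝ → ℝ) (r θ : ℝ) : ℝ :=
  1 + deriv h r - deriv h r * Real.cos (θ * Θ r)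

/-- The defining properties of the family of stretching bijections `g_r`. -/
def IsGFamily (h Θ : ℝ → ℝ) (δ : ℝ) (g : ℝ → ℝ → ℝ) : Prop :=
  ∀ r ∈ Set.Ioo (0:ℝ) (1/2),
    StrictMonoOn (g r) (Set.Icc (-1:ℝ) 1) ∧
    Set.BijOn (g r) (Set.Icc (-1:ℝ) 1) (Set.Icc (-1:ℝ) 1) ∧
    g r (-1) = -1 ∧ g r 1 = 1 ∧
    (∀ ℓ ∈ Set.Icc (-1:ℝ) 0,
      (1 + δ) * ∫ θ in (-1:ℝ)..ℓ, wgt h Θ r θ = ∫ θ in (-1:ℝ)..(g r ℓ), wgt h Θ r θ) ∧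
    (∀ ℓ ∈ Set.Icc (0:ℝ) 1,
      (1 - δ) * ∫ θ in ℓ..(1:ℝ), wgt h Θ r θ = ∫ θ in (g r ℓ)..(1:ℝ), wgt h Θ r θ)

/-- The defining properties of the map `Ψ_δ` in terms of `K` and the family `g`. -/
def IsPsi (K : ℝ × ℝ → ℝ × ℝ) (δ : ℝ) (g : ℝ → ℝ → ℝ) (Ψ : ℝ × ℝ → ℝ × ℝ) : Prop :=
  (∀ x ∈ lowerDom, Ψ x ∈ lowerDom ∧ (K (Ψ x)).1 = (K x).1 ∧
      (K (Ψ x)).2 = g (K x).1 (K x).2) ∧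
  Ψ (1/2, 0) = (1/2, 0) ∧
  (∀ x ∈ unitSq, 1/2 < x.2 → Ψ x = ((Ψ (x.1, 1 - x.2)).1, 1 - (Ψ (x.1, 1 - x.2)).2)) ∧
  (∀ x₁ : ℝ, 0 ≤ x₁ → x₁ ≤ 1/2 → Ψ (x₁, 1/2) = ((1 + δ) * x₁, 1/2)) ∧
  (∀ x₁ : ℝ, 1/2 ≤ x₁ → x₁ ≤ 1 → Ψ (x₁, 1/2) = ((1 + δ)/2 + (1 - δ) * (x₁ - 1/2), 1/2))

/-- The crack: the vertical line `x₁ = 1/2`. -/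
def crack : Set (ℝ × ℝ) := {x : ℝ × ℝ | x.1 = 1/2}

/-- The seams: `S¹ = K⁻¹({r = r₀})` together with its reflection `S²` in the line
`x₂ = 1/2`. -/
def seams (r₀ : ℝ) (K : ℝ × ℝ → ℝ × ℝ) : Set (ℝ × ℝ) :=
  {x ∈ lowerDom | (K x).1 = r₀} ∪
  {x : ℝ × ℝ | (x.1, 1 - x.2) ∈ lowerDom ∧ (K (x.1, 1 - x.2)).1 = r₀}


/-! ### Elementary functions of the angle -/

/-- the weight as a function of `p = h'(r)` and the angle -/
def wf (p φ : ℝ) : ℝ := 1 + p - p * Real.cos φ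
/-- primitive of the weight -/
def Wf (p φ : ℝ) : ℝ := (1 + p) * φ - p * Real.sin φ
/-- `φ - sin φ` -/
def sf (φ : ℝ) : ℝ := φ - Real.sin φ
/-- auxiliary -/
def uf (p φ : ℝ) : ℝ := wf p φ * Real.sin φ - Wf p φ

lemma hasDerivAt_sf (x : ℝ) : HasDerivAt sf (1 - Real.cos x) x := by
  unfold sf
  exact (hasDerivAt_id x).sub (Real.hasDerivAt_sin x)

lemma hasDerivAt_Wf (p x : ℝ) : HasDerivAt (Wf p) (wf p x) x := by
  unfold Wf wf
  have := ((hasDerivAt_id x).const_mul (1 + p)).sub ((Real.hasDerivAt_sin x).const_mul p)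
  exact this.congr_deriv (by simp)

lemma hasDerivAt_wf (p x : ℝ) : HasDerivAt (wf p) (p * Real.sin x) x := by
  unfold wf
  have := ((Real.hasDerivAt_cos x).const_mul p).const_sub (1 + p)
  simpa using this

lemma hasDerivAt_uf (p x : ℝ) :
    HasDerivAt (uf p) ((1 - Real.cos x) * (-1 + 2 * p * Real.cos x)) x := by
  unfold uf
  have := ((hasDerivAt_wf p x).mul (Real.hasDerivAt_sin x)).sub (hasDerivAt_Wf p x)
  refine this.congr_deriv ?_
  unfold wf
  have h := Real.sin_sq_add_cos_sq x
  linear_combination (p) * h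

lemma one_sub_cos_le {Θ x : ℝ} (hx : |x| ≤ Θ) : 1 - Real.cos x ≤ Θ ^ 2 / 2 := by
  have h := Real.one_sub_sq_div_two_le_cos (x := x)
  have h2 : x ^ 2 ≤ Θ ^ 2 := by
    rw [← sq_abs x]; gcongr
  linarith

lemma lip_of_deriv {f f' : ℝ → ℝ} {Θ C a b : ℝ} (hf : ∀ x, HasDerivAt f (f' x) x)
    (hb : ∀ x, |x| ≤ Θ → |f' x| ≤ C) (ha : |a| ≤ Θ) (hb' : |b| ≤ Θ) :
    |f a - f b| ≤ C * |a - b| := by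
  have := Convex.norm_image_sub_le_of_norm_hasDerivWithin_le (f := f) (f' := f')
    (s := Set.Icc (-Θ) Θ) (C := C) (x := b) (y := a)
    (fun x _ => (hf x).hasDerivWithinAt) (fun x hx => by
      simpa using hb x (abs_le.2 hx)) (convex_Icc _ _) (abs_le.1 hb') (abs_le.1 ha)
  simpa using this

lemma sf_lip {Θ a b : ℝ} (ha : |a| ≤ Θ) (hb : |b| ≤ Θ) : |sf a - sf b| ≤ Θ ^ 2 * |a - b| := by
  refine lip_of_deriv hasDerivAt_sf (fun x hx => ?_) ha hb
  have h1 := one_sub_cos_le hx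
  have h2 := Real.cos_le_one x
  rw [abs_of_nonneg (by linarith)]
  nlinarith [sq_nonneg Θ]

lemma cos_lip {Θ a b : ℝ} (ha : |a| ≤ Θ) (hb : |b| ≤ Θ) :
    |Real.cos a - Real.cos b| ≤ Θ * |a - b| := by
  refine lip_of_deriv Real.hasDerivAt_cos (fun x hx => ?_) ha hb
  rw [abs_neg]
  exact (Real.abs_sin_le_abs.trans hx)

lemma uf_lip {p Θ a b : ℝ} (hp : 0 ≤ p) (ha : |a| ≤ Θ) (hb : |b| ≤ Θ) :
    |uf p a - uf p b| ≤ (Θ ^ 2 + p * Θ ^ 2) * |a - b| := by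
  refine lip_of_deriv (hasDerivAt_uf p) (fun x hx => ?_) ha hb
  have h1 := one_sub_cos_le hx
  have h2 := Real.cos_le_one x
  have h3 : |(-1 + 2 * p * Real.cos x)| ≤ 1 + 2 * p := by
    have := Real.neg_one_le_cos x
    rw [abs_le]; constructor <;> nlinarith
  rw [abs_mul, abs_of_nonneg (by linarith : 0 ≤ 1 - Real.cos x)]
  calc _ ≤ (Θ ^ 2 / 2) * (1 + 2 * p) := by gcongr
    _ ≤ _ := by nlinarith [sq_nonneg Θ]

@[simp] lemma sf_zero : sf 0 = 0 := by simp [sf]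
@[simp] lemma uf_zero (p : ℝ) : uf p 0 = 0 := by simp [uf, Wf]
@[simp] lemma Wf_zero (p : ℝ) : Wf p 0 = 0 := by simp [Wf]
lemma sf_neg (x : ℝ) : sf (-x) = - sf x := by simp [sf]; ring
lemma Wf_neg (p x : ℝ) : Wf p (-x) = - Wf p x := by simp [Wf]; ring
lemma Wf_eq (p x : ℝ) : Wf p x = x + p * sf x := by simp [Wf, sf]; ring

lemma sf_abs_le {Θ a : ℝ} (ha : |a| ≤ Θ) : |sf a| ≤ Θ ^ 3 := by
  have h0 : |(0:ℝ)| ≤ Θ := by simpa using (abs_nonneg a).trans ha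
  have := sf_lip ha h0
  simp only [sf_zero, sub_zero] at this
  calc _ ≤ _ := this
    _ ≤ Θ ^ 2 * Θ := by gcongr
    _ = _ := by ring

lemma uf_abs_le {p Θ a : ℝ} (hp : 0 ≤ p) (ha : |a| ≤ Θ) :
    |uf p a| ≤ (Θ ^ 2 + p * Θ ^ 2) * Θ := by
  have h0 : |(0:ℝ)| ≤ Θ := by simpa using (abs_nonneg a).trans ha
  have := uf_lip hp ha h0
  simp only [uf_zero, sub_zero] at this
  calc _ ≤ _ := this
    _ ≤ _ := by gcongr

lemma sf_mono {a b : ℝ} (hab : a ≤ b) : sf a ≤ sf b := by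
  have := Real.abs_sin_sub_sin_le b a
  rw [abs_of_nonneg (sub_nonneg.2 hab)] at this
  have := (abs_le.1 this).2
  unfold sf; linarith

lemma Wf_expand {p : ℝ} (hp : 0 ≤ p) (a b : ℝ) : |a - b| ≤ |Wf p a - Wf p b| := by
  rw [Wf_eq, Wf_eq]
  rcases le_total a b with hab | hab
  · have := mul_le_mul_of_nonneg_left (sf_mono hab) hp
    rw [abs_of_nonpos (by linarith), abs_of_nonpos (by linarith)]; linarith
  · have := mul_le_mul_of_nonneg_left (sf_mono hab) hp
    rw [abs_of_nonneg (by linarith), abs_of_nonneg (by linarith)]; linarith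

lemma Wf_mono {p : ℝ} (hp : 0 ≤ p) {a b : ℝ} (hab : a ≤ b) : Wf p a ≤ Wf p b := by
  have := mul_le_mul_of_nonneg_left (sf_mono hab) hp
  rw [Wf_eq, Wf_eq]; linarith

lemma Wf_inj {p : ℝ} (hp : 0 ≤ p) {a b : ℝ} (hab : Wf p a = Wf p b) : a = b := by
  have := Wf_expand hp a b
  rw [hab, sub_self, abs_zero] at this
  linarith [abs_nonpos_iff.1 this]

lemma one_le_wf {p : ℝ} (hp : 0 ≤ p) (a : ℝ) : 1 ≤ wf p a := by
  have := Real.cos_le_one a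
  unfold wf; nlinarith

lemma wf_le {p Θ : ℝ} (hp : 0 ≤ p) (hΘ : 0 ≤ Θ) : wf p Θ ≤ 1 + p * Θ ^ 2 := by
  have := one_sub_cos_le (abs_of_nonneg hΘ).le
  unfold wf; nlinarith [sq_nonneg Θ, mul_nonneg hp (sq_nonneg Θ)]

lemma Wf_le {p Θ : ℝ} (hp : 0 ≤ p) (hΘ : 0 ≤ Θ) : Wf p Θ ≤ Θ * (1 + p * Θ ^ 2) := by
  have := (le_abs_self _).trans (sf_abs_le (abs_of_nonneg hΘ).le)
  rw [Wf_eq]; nlinarith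

/-- All the numerical hypotheses at one point. -/
structure Pt (p Θ φ ψ δ σ : ℝ) : Prop where
  hp : 0 ≤ p
  hΘ : 0 < Θ
  hφ : |φ| ≤ Θ
  hψ : |ψ| ≤ Θ
  hδ : |δ| < 1
  hσ : σ = 1 ∨ σ = -1
  hs : 0 ≤ σ * φ
  hW : Wf p ψ = (1 - σ * δ) * Wf p φ + δ * Wf p Θ

lemma Pt.hσ' {p Θ φ ψ δ σ : ℝ} (H : Pt p Θ φ ψ δ σ) : |σ| = 1 := by
  rcases H.hσ with h | h <;> simp [h]

lemma Pt.diff {p Θ φ ψ δ σ : ℝ} (H : Pt p Θ φ ψ δ σ) :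
    |ψ - φ| ≤ |δ| * (Θ * (1 + p * Θ ^ 2)) := by
  have h1 := Wf_expand H.hp ψ φ
  have h2 : Wf p ψ - Wf p φ = δ * (Wf p Θ - σ * Wf p φ) := by rw [H.hW]; ring
  have h3 : 0 ≤ Wf p Θ - σ * Wf p φ ∧ Wf p Θ - σ * Wf p φ ≤ Wf p Θ := by
    have hφ := abs_le.1 H.hφ
    have hs := H.hs
    rcases H.hσ with h | h
    · subst h
      have a := Wf_mono H.hp hφ.2
      have b := Wf_mono H.hp (a := 0) (b := φ) (by linarith)
      rw [Wf_zero] at b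
      constructor <;> linarith
    · subst h
      have a := Wf_mono H.hp hφ.1
      have b := Wf_mono H.hp (a := φ) (b := 0) (by linarith)
      rw [Wf_zero] at b
      rw [Wf_neg] at a
      constructor <;> linarith
  rw [h2, abs_mul, abs_of_nonneg h3.1] at h1
  refine h1.trans ?_
  gcongr
  exact h3.2.trans (Wf_le H.hp H.hΘ.le)

lemma Pt.wdiff {p Θ φ ψ δ σ : ℝ} (H : Pt p Θ φ ψ δ σ) :
    |wf p ψ - wf p φ| ≤ |δ| * ((p * Θ ^ 2) * (1 + p * Θ ^ 2)) := by
  have h1 := cos_lip H.hφ H.hψ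
  have h2 : wf p ψ - wf p φ = p * (Real.cos φ - Real.cos ψ) := by unfold wf; ring
  rw [h2, abs_mul, abs_of_nonneg H.hp]
  rw [abs_sub_comm φ] at h1
  have := H.hp
  have := H.hΘ.le
  calc _ ≤ p * (Θ * (|δ| * (Θ * (1 + p * Θ ^ 2)))) := by
        refine mul_le_mul_of_nonneg_left (h1.trans ?_) H.hp
        exact mul_le_mul_of_nonneg_left H.diff this
    _ = _ := by ring

lemma abs_div_sub_one {a b C : ℝ} (hb : 1 ≤ b) (h : |a - b| ≤ C) : |a / b - 1| ≤ C := by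
  have : a / b - 1 = (a - b) / b := by field_simp
  rw [this, abs_div, abs_of_pos (by linarith : 0 < b)]
  exact (div_le_self (abs_nonneg _) hb).trans h

/-- the shear term -/
def Bf (p R φ ψ δ σ N : ℝ) : ℝ :=
  (p * Real.sin ψ - p * ((1 - σ * δ) * wf p φ / wf p ψ) * Real.sin φ + R * N / wf p ψ) / wf p φ

/-- `w̃ ∂φ̃/∂r`, where `T = Θ'(r)` -/
def Nf (p q Θ T φ ψ δ σ : ℝ) : ℝ :=
  (1 - σ * δ) * (q * sf φ) + δ * (q * sf Θ + wf p Θ * T) - q * sf ψ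

/-- bound for the shear term -/
def E3 (p q R Θ T : ℝ) : ℝ :=
  (p * Θ ^ 3 + p ^ 2 * Θ ^ 3) * (2 + p * Θ ^ 2) + R * |q| * Θ ^ 3 * (3 + p * Θ ^ 2)
    + |p * Wf p Θ + R * T * wf p Θ|

lemma Pt.shear {p q R T Θ φ ψ δ σ : ℝ} (H : Pt p Θ φ ψ δ σ) (hR : 0 < R) :
    |Bf p R φ ψ δ σ (Nf p q Θ T φ ψ δ σ)| ≤ |δ| * E3 p q R Θ T := by
  have w1 := one_le_wf H.hp φ
  have w2 := one_le_wf H.hp ψ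
  have hp := H.hp
  have hΘ := H.hΘ.le
  have e : Bf p R φ ψ δ σ (Nf p q Θ T φ ψ δ σ) * (wf p φ * wf p ψ) =
      p * ((uf p ψ - uf p φ) + σ * δ * uf p φ)
      + R * q * ((sf φ - sf ψ) - σ * δ * sf φ + δ * sf Θ)
      + δ * (p * Wf p Θ + R * T * wf p Θ) := by
    have hW := H.hW
    have a1 : wf p φ ≠ 0 := by linarith
    have a2 : wf p ψ ≠ 0 := by linarith
    unfold Bf Nf uf
    field_simp
    linear_combination (p) * hW
  have hd := H.diff
  have b1 : |uf p ψ - uf p φ| ≤ |δ| * ((Θ ^ 2 + p * Θ ^ 2) * (Θ * (1 + p * Θ ^ 2))) := by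
    refine (uf_lip hp H.hψ H.hφ).trans ?_
    calc _ ≤ (Θ ^ 2 + p * Θ ^ 2) * (|δ| * (Θ * (1 + p * Θ ^ 2))) := by gcongr
      _ = _ := by ring
  have b2 : |σ * δ * uf p φ| ≤ |δ| * ((Θ ^ 2 + p * Θ ^ 2) * Θ) := by
    rw [abs_mul, abs_mul, H.hσ', one_mul]
    gcongr
    exact uf_abs_le hp H.hφ
  have b3 : |sf φ - sf ψ| ≤ |δ| * (Θ ^ 2 * (Θ * (1 + p * Θ ^ 2))) := by
    refine (sf_lip H.hφ H.hψ).trans ?_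
    rw [abs_sub_comm φ]
    calc _ ≤ (Θ ^ 2) * (|δ| * (Θ * (1 + p * Θ ^ 2))) := by gcongr
      _ = _ := by ring
  have b4 : |σ * δ * sf φ| ≤ |δ| * Θ ^ 3 := by
    rw [abs_mul, abs_mul, H.hσ', one_mul]
    gcongr
    exact sf_abs_le H.hφ
  have b5 : |δ * sf Θ| ≤ |δ| * Θ ^ 3 := by
    rw [abs_mul]
    gcongr
    exact sf_abs_le (abs_of_nonneg hΘ).le
  have key : |Bf p R φ ψ δ σ (Nf p q Θ T φ ψ δ σ) * (wf p φ * wf p ψ)| ≤ |δ| * E3 p q R Θ T := by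
    rw [e]
    refine (abs_add_three _ _ _).trans ?_
    have c1 : |p * ((uf p ψ - uf p φ) + σ * δ * uf p φ)| ≤
        p * (|δ| * ((Θ ^ 2 + p * Θ ^ 2) * (Θ * (1 + p * Θ ^ 2))) +
          |δ| * ((Θ ^ 2 + p * Θ ^ 2) * Θ)) := by
      rw [abs_mul, abs_of_nonneg hp]
      refine mul_le_mul_of_nonneg_left ((abs_add_le _ _).trans ?_) hp
      linarith
    have c2 : |R * q * ((sf φ - sf ψ) - σ * δ * sf φ + δ * sf Θ)| ≤
        R * |q| * (|δ| * (Θ ^ 2 * (Θ * (1 + p * Θ ^ 2))) + |δ| * Θ ^ 3 + |δ| * Θ ^ 3) := by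
      rw [abs_mul, abs_mul, abs_of_pos hR]
      refine mul_le_mul_of_nonneg_left ?_ (by positivity)
      have t1 := abs_add_le ((sf φ - sf ψ) - σ * δ * sf φ) (δ * sf Θ)
      have t2 := abs_sub (sf φ - sf ψ) (σ * δ * sf φ)
      linarith
    have c3 : |δ * (p * Wf p Θ + R * T * wf p Θ)| = |δ| * |p * Wf p Θ + R * T * wf p Θ| :=
      abs_mul _ _
    rw [c3]
    unfold E3
    nlinarith [c1, c2]
  rw [abs_mul, abs_of_pos (by positivity : 0 < wf p φ * wf p ψ)] at key
  have : 1 ≤ wf p φ * wf p ψ := one_le_mul_of_one_le_of_one_le w1 w2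
  exact (le_mul_of_one_le_right (abs_nonneg _) this).trans key

/-- total error bound -/
def EE (p q R Θ T : ℝ) : ℝ :=
  3 * (p * Θ ^ 2 * (1 + p * Θ ^ 2)) * (1 + Θ) + E3 p q R Θ T + Θ * (1 + p * Θ ^ 2) + 2 * Θ

lemma abs_mul3_le {a b c C : ℝ} (ha : |a| ≤ 1) (hb : |b| ≤ 1) (hc : |c| ≤ C) :
    |a * b * c| ≤ C := by
  rw [abs_mul, abs_mul]
  calc _ ≤ 1 * 1 * C := by gcongr
    _ = C := by ring

lemma Pt.entries {p q R T Θ φ ψ δ σ A a B : ℝ} (H : Pt p Θ φ ψ δ σ) (hR : 0 < R)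
    (hA : A = wf p ψ / wf p φ) (ha : a = (1 - σ * δ) * wf p φ / wf p ψ)
    (hB : B = Bf p R φ ψ δ σ (Nf p q Θ T φ ψ δ σ)) :
    |Real.sin φ * Real.sin ψ * A + (B * Real.sin φ + a * Real.cos φ) * Real.cos ψ - (1 - σ * δ)|
      ≤ |δ| * EE p q R Θ T ∧
    |Real.cos φ * Real.sin ψ * A + (B * Real.cos φ - a * Real.sin φ) * Real.cos ψ|
      ≤ |δ| * EE p q R Θ T ∧
    |Real.sin φ * Real.cos ψ * A - (B * Real.sin φ + a * Real.cos φ) * Real.sin ψ|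
      ≤ |δ| * EE p q R Θ T ∧
    |Real.cos φ * Real.cos ψ * A - (B * Real.cos φ - a * Real.sin φ) * Real.sin ψ - 1|
      ≤ |δ| * EE p q R Θ T := by
  have hp := H.hp
  have hΘ := H.hΘ.le
  set e2 := |δ| * ((p * Θ ^ 2) * (1 + p * Θ ^ 2)) with he2
  have e2n : 0 ≤ e2 := by positivity
  have dA : |A - 1| ≤ e2 := by rw [hA]; exact abs_div_sub_one (one_le_wf hp φ) H.wdiff
  have hσδ : |σ * δ| = |δ| := by rw [abs_mul, H.hσ', one_mul]
  have hσδ2 : |1 - σ * δ| ≤ 2 := by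
    have := abs_sub 1 (σ * δ)
    rw [hσδ, abs_one] at this
    linarith [H.hδ]
  have da : |a - (1 - σ * δ)| ≤ 2 * e2 := by
    have : a - (1 - σ * δ) = (1 - σ * δ) * (wf p φ / wf p ψ - 1) := by rw [ha]; ring
    rw [this, abs_mul]
    have h2 : |wf p φ / wf p ψ - 1| ≤ e2 :=
      abs_div_sub_one (one_le_wf hp ψ) (by rw [abs_sub_comm]; exact H.wdiff)
    gcongr
  have da1 : |a - 1| ≤ |δ| + 2 * e2 := by
    have : a - 1 = (a - (1 - σ * δ)) + (- (σ * δ)) := by ring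
    rw [this]
    refine (abs_add_le _ _).trans ?_
    rw [abs_neg, hσδ]; linarith
  have dB : |B| ≤ |δ| * E3 p q R Θ T := by rw [hB]; exact H.shear hR
  have dd := H.diff
  have sφ : |Real.sin φ| ≤ 1 := Real.abs_sin_le_one _
  have sψ : |Real.sin ψ| ≤ 1 := Real.abs_sin_le_one _
  have cφ : |Real.cos φ| ≤ 1 := Real.abs_cos_le_one _
  have cψ : |Real.cos ψ| ≤ 1 := Real.abs_cos_le_one _
  have sφ' : |Real.sin φ| ≤ Θ := Real.abs_sin_le_abs.trans H.hφ
  have sψ' : |Real.sin ψ| ≤ Θ := Real.abs_sin_le_abs.trans H.hψ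
  have c1 : |Real.cos (ψ - φ) - 1| ≤ |ψ - φ| := by
    have := Real.abs_cos_sub_cos_le (ψ - φ) 0
    simpa using this
  have c2 : |Real.sin (ψ - φ)| ≤ |ψ - φ| := Real.abs_sin_le_abs
  have c3 : |1 - Real.cos φ * Real.cos ψ| ≤ 2 * Θ := by
    have t1 := Real.abs_cos_sub_cos_le φ 0
    have t2 := Real.abs_cos_sub_cos_le ψ 0
    rw [Real.cos_zero, sub_zero, abs_sub_comm] at t1 t2
    have : 1 - Real.cos φ * Real.cos ψ = (1 - Real.cos φ) + Real.cos φ * (1 - Real.cos ψ) := by ring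
    rw [this]
    refine (abs_add_le _ _).trans ?_
    rw [abs_mul]
    have : |Real.cos φ| * |1 - Real.cos ψ| ≤ 1 * |ψ| := by gcongr
    linarith [H.hφ, H.hψ]
  have EEe : |δ| * EE p q R Θ T = 3 * e2 * (1 + Θ) + |δ| * E3 p q R Θ T
      + |δ| * (Θ * (1 + p * Θ ^ 2)) + 2 * |δ| * Θ := by
    rw [he2]; unfold EE; ring
  rw [EEe]
  clear_value e2
  have dE1 : 0 ≤ |δ| * (Θ * (1 + p * Θ ^ 2)) := by positivity
  have d0 := abs_nonneg δ
  have dT : 0 ≤ |δ| * Θ := by positivity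
  have eT : 0 ≤ e2 * Θ := by positivity
  have prodT : ∀ x y : ℝ, |x| ≤ Θ → |y| ≤ 1 → |(a - 1) * x * y| ≤ (|δ| + 2 * e2) * Θ := by
    intro x y hx hy
    rw [abs_mul, abs_mul]
    calc _ ≤ (|δ| + 2 * e2) * Θ * 1 := by gcongr
      _ = _ := by ring
  refine ⟨?_, ?_, ?_, ?_⟩
  · have i1 := abs_mul3_le sφ sψ dA
    have i2 := abs_mul3_le sφ cψ dB
    have i3 := abs_mul3_le cφ cψ da
    have i4 : |σ * δ * (1 - Real.cos φ * Real.cos ψ)| ≤ |δ| * (2 * Θ) := by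
      rw [abs_mul, hσδ]; gcongr
    have e : Real.sin φ * Real.sin ψ * A + (B * Real.sin φ + a * Real.cos φ) * Real.cos ψ
        - (1 - σ * δ) = Real.sin φ * Real.sin ψ * (A - 1) + Real.sin φ * Real.cos ψ * B
          + Real.cos φ * Real.cos ψ * (a - (1 - σ * δ)) + (Real.cos (ψ - φ) - 1)
          + σ * δ * (1 - Real.cos φ * Real.cos ψ) := by
      rw [Real.cos_sub]; ring
    rw [e]
    have j1 := abs_add_le (Real.sin φ * Real.sin ψ * (A - 1) + Real.sin φ * Real.cos ψ * B
          + Real.cos φ * Real.cos ψ * (a - (1 - σ * δ)) + (Real.cos (ψ - φ) - 1))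
          (σ * δ * (1 - Real.cos φ * Real.cos ψ))
    have j2 := abs_add_le (Real.sin φ * Real.sin ψ * (A - 1) + Real.sin φ * Real.cos ψ * B
          + Real.cos φ * Real.cos ψ * (a - (1 - σ * δ))) (Real.cos (ψ - φ) - 1)
    have j3 := abs_add_three (Real.sin φ * Real.sin ψ * (A - 1)) (Real.sin φ * Real.cos ψ * B)
          (Real.cos φ * Real.cos ψ * (a - (1 - σ * δ)))
    linarith
  · have i1 := abs_mul3_le cφ sψ dA
    have i2 := abs_mul3_le cφ cψ dB
    have i3 := prodT _ _ sφ' cψ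
    have e : Real.cos φ * Real.sin ψ * A + (B * Real.cos φ - a * Real.sin φ) * Real.cos ψ
        = Real.cos φ * Real.sin ψ * (A - 1) + Real.cos φ * Real.cos ψ * B
          + Real.sin (ψ - φ) - (a - 1) * Real.sin φ * Real.cos ψ := by
      rw [Real.sin_sub]; ring
    rw [e]
    have j2 := abs_sub (Real.cos φ * Real.sin ψ * (A - 1) + Real.cos φ * Real.cos ψ * B
          + Real.sin (ψ - φ)) ((a - 1) * Real.sin φ * Real.cos ψ)
    have j3 := abs_add_three (Real.cos φ * Real.sin ψ * (A - 1)) (Real.cos φ * Real.cos ψ * B)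
          (Real.sin (ψ - φ))
    linarith
  · have i1 := abs_mul3_le sφ cψ dA
    have i2 := abs_mul3_le sφ sψ dB
    have i3 := prodT _ _ sψ' cφ
    have e : Real.sin φ * Real.cos ψ * A - (B * Real.sin φ + a * Real.cos φ) * Real.sin ψ
        = Real.sin φ * Real.cos ψ * (A - 1) - Real.sin φ * Real.sin ψ * B
          - Real.sin (ψ - φ) - (a - 1) * Real.sin ψ * Real.cos φ := by
      rw [Real.sin_sub]; ring
    rw [e]
    have j2 := abs_sub (Real.sin φ * Real.cos ψ * (A - 1) - Real.sin φ * Real.sin ψ * B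
          - Real.sin (ψ - φ)) ((a - 1) * Real.sin ψ * Real.cos φ)
    have j3 := abs_sub (Real.sin φ * Real.cos ψ * (A - 1) - Real.sin φ * Real.sin ψ * B)
          (Real.sin (ψ - φ))
    have j4 := abs_sub (Real.sin φ * Real.cos ψ * (A - 1)) (Real.sin φ * Real.sin ψ * B)
    linarith
  · have i1 := abs_mul3_le cφ cψ dA
    have i2 := abs_mul3_le cφ sψ dB
    have i3 := prodT _ _ sφ' sψ
    have e : Real.cos φ * Real.cos ψ * A - (B * Real.cos φ - a * Real.sin φ) * Real.sin ψ - 1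
        = Real.cos φ * Real.cos ψ * (A - 1) - Real.cos φ * Real.sin ψ * B
          + (Real.cos (ψ - φ) - 1) + (a - 1) * Real.sin φ * Real.sin ψ := by
      rw [Real.cos_sub]; ring
    rw [e]
    have j2 := abs_add_le (Real.cos φ * Real.cos ψ * (A - 1) - Real.cos φ * Real.sin ψ * B
          + (Real.cos (ψ - φ) - 1)) ((a - 1) * Real.sin φ * Real.sin ψ)
    have j3 := abs_add_le (Real.cos φ * Real.cos ψ * (A - 1) - Real.cos φ * Real.sin ψ * B)
          (Real.cos (ψ - φ) - 1)
    have j4 := abs_sub (Real.cos φ * Real.cos ψ * (A - 1)) (Real.cos φ * Real.sin ψ * B)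
    linarith


/-! ### Facts about `h` -/

section hfacts
variable {h : ℝ → ℝ}

lemma GoodH.contDiffAt (hh : GoodH h) {r : ℝ} (hr : r ∈ Ioo (0:ℝ) (1/2)) : ContDiffAt ℝ 3 h r :=
  hh.2.2.2.2.1.contDiffAt (Ico_mem_nhds hr.1 hr.2)

lemma GoodH.contDiffAt1 (hh : GoodH h) {r : ℝ} (hr : r ∈ Ioo (0:ℝ) (1/2)) :
    ContDiffAt ℝ 2 (deriv h) r :=
  (hh.contDiffAt hr).derivWithin (by norm_num)

lemma GoodH.contDiffAt2 (hh : GoodH h) {r : ℝ} (hr : r ∈ Ioo (0:ℝ) (1/2)) :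
    ContDiffAt ℝ 1 (deriv (deriv h)) r :=
  (hh.contDiffAt1 hr).derivWithin (by norm_num)

lemma GoodH.hasDerivAt (hh : GoodH h) {r : ℝ} (hr : r ∈ Ioo (0:ℝ) (1/2)) :
    HasDerivAt h (deriv h r) r :=
  ((hh.contDiffAt hr).differentiableAt (by norm_num)).hasDerivAt

lemma GoodH.hasDerivAt1 (hh : GoodH h) {r : ℝ} (hr : r ∈ Ioo (0:ℝ) (1/2)) :
    HasDerivAt (deriv h) (deriv (deriv h) r) r :=
  ((hh.contDiffAt1 hr).differentiableAt (by norm_num)).hasDerivAt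

lemma GoodH.hasDerivAt2 (hh : GoodH h) {r : ℝ} (hr : r ∈ Ioo (0:ℝ) (1/2)) :
    HasDerivAt (deriv (deriv h)) (deriv (deriv (deriv h)) r) r :=
  ((hh.contDiffAt2 hr).differentiableAt (by norm_num)).hasDerivAt

lemma GoodH.deriv_nonneg (hh : GoodH h) {r : ℝ} (hr : r ∈ Ioo (0:ℝ) (1/2)) : 0 ≤ deriv h r := by
  have := hh.2.1.derivWithin_nonneg (x := r)
  rwa [derivWithin_of_mem_nhds (Ico_mem_nhds hr.1 hr.2)] at this

lemma GoodH.nonneg (hh : GoodH h) {r : ℝ} (hr : r ∈ Ioo (0:ℝ) (1/2)) : 0 ≤ h r :=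
  hh.1 r ⟨hr.1.le, hr.2⟩

lemma GoodH.R_pos (hh : GoodH h) {r : ℝ} (hr : r ∈ Ioo (0:ℝ) (1/2)) : 0 < r + h r := by
  have := hh.nonneg hr
  linarith [hr.1]

lemma GoodH.mono (hh : GoodH h) {r s : ℝ} (hr : r ∈ Ioo (0:ℝ) (1/2)) (hs : s ∈ Ioo (0:ℝ) (1/2))
    (hrs : r ≤ s) : h r ≤ h s :=
  hh.2.1 ⟨hr.1.le, hr.2⟩ ⟨hs.1.le, hs.2⟩ hrs

lemma GoodH.small (hh : GoodH h) {r : ℝ} (hr : 0 < r) (hr' : r < 1/10) :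
    h r = 0 ∧ deriv h r = 0 ∧ deriv (deriv h) r = 0 := by
  have e : ∀ s ∈ Ioo (0:ℝ) (1/10), h =ᶠ[nhds s] fun _ => 0 := by
    intro s hs
    filter_upwards [Ioo_mem_nhds hs.1 hs.2] with t ht
    exact hh.2.2.1 t ⟨ht.1.le, ht.2.le⟩
  have e1 : ∀ s ∈ Ioo (0:ℝ) (1/10), deriv h s = 0 := by
    intro s hs
    rw [(e s hs).deriv_eq]; simp
  have e2 : deriv h =ᶠ[nhds r] fun _ => 0 := by
    filter_upwards [Ioo_mem_nhds hr hr'] with t ht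
    exact e1 t ht
  refine ⟨hh.2.2.1 r ⟨hr.le, hr'.le⟩, e1 r ⟨hr, hr'⟩, ?_⟩
  rw [e2.deriv_eq]; simp

lemma GoodH.growth (hh : GoodH h) : ∃ c : ℝ, 0 ≤ c ∧ ∀ r ∈ Ioo (0:ℝ) (1/2),
    (deriv h r) ^ 2 ≤ c * (r + h r) ^ 3 ∧ |deriv (deriv h) r| ≤ c * (r + h r) ^ 2 ∧
    ∀ a ∈ Ioo (0:ℝ) (1/2), a ≤ r →
      (deriv h r) ^ 2 - (deriv h a) ^ 2 ≤ c * (r - a) * (r + h r) ^ 3 ∧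
      |deriv (deriv h) r - deriv (deriv h) a| ≤ c * (r - a) * (r + h r) ^ 2 := by
  obtain ⟨c, hc⟩ := hh.2.2.2.2.2
  have hc0 : 0 ≤ c := by
    have h1 := (hc (1/20) (by norm_num)).1
    rw [hh.2.2.1 (1/20) (by norm_num)] at h1
    nlinarith [sq_nonneg (deriv h (1/20))]
  have key : ∀ r ∈ Ioo (0:ℝ) (1/2), ∀ a ∈ Ioo (0:ℝ) (1/2), a ≤ r →
      (deriv h r) ^ 2 - (deriv h a) ^ 2 ≤ (2 * c) * (r - a) * (r + h r) ^ 3 ∧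
      |deriv (deriv h) r - deriv (deriv h) a| ≤ (2 * c) * (r - a) * (r + h r) ^ 2 := by
    intro r hr a ha har
    have sub : ∀ t ∈ Icc a r, t ∈ Ioo (0:ℝ) (1/2) := fun t ht =>
      ⟨ha.1.trans_le ht.1, ht.2.trans_lt hr.2⟩
    have Rle : ∀ t ∈ Icc a r, t + h t ≤ r + h r := fun t ht =>
      add_le_add ht.2 (hh.mono (sub t ht) hr ht.2)
    have D1 : ∀ t ∈ Icc a r, HasDerivAt (fun t => (deriv h t) ^ 2)
        (2 * deriv h t * deriv (deriv h) t) t := by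
      intro t ht
      have := (hh.hasDerivAt1 (sub t ht)).pow 2
      exact this.congr_deriv (by simp)
    constructor
    · have := Convex.image_sub_le_mul_sub_of_deriv_le (convex_Icc a r)
        (f := fun t => (deriv h t) ^ 2) (C := 2 * (c * (r + h r) ^ 3))
        (fun t ht => (D1 t ht).continuousAt.continuousWithinAt)
        (fun t ht => (D1 t (interior_subset ht)).differentiableAt.differentiableWithinAt)
        (fun t ht => by
          have ht := interior_subset ht
          rw [(D1 t ht).deriv]
          have h1 := (hc t ⟨(sub t ht).1.le, (sub t ht).2⟩).2.1
          have h2 : c * (t + h t) ^ 3 ≤ c * (r + h r) ^ 3 := by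
            have := (hh.R_pos (sub t ht)).le
            have := Rle t ht
            gcongr
          linarith) a ⟨le_rfl, har⟩ r ⟨har, le_rfl⟩ har
      linarith
    · have := Convex.norm_image_sub_le_of_norm_hasDerivWithin_le (f := deriv (deriv h))
        (f' := deriv (deriv (deriv h))) (s := Icc a r) (C := c * (r + h r) ^ 2) (x := a) (y := r)
        (fun t ht => (hh.hasDerivAt2 (sub t ht)).hasDerivWithinAt)
        (fun t ht => by
          have h1 := (hc t ⟨(sub t ht).1.le, (sub t ht).2⟩).2.2
          refine h1.trans ?_
          have := (hh.R_pos (sub t ht)).le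
          have := Rle t ht
          gcongr) (convex_Icc _ _) ⟨le_rfl, har⟩ ⟨har, le_rfl⟩
      rw [Real.norm_eq_abs, Real.norm_eq_abs, abs_of_nonneg (sub_nonneg.2 har)] at this
      have h2 : 0 ≤ c * (r + h r) ^ 2 * (r - a) := by
        have := sub_nonneg.2 har
        positivity
      linarith
  refine ⟨2 * c, by positivity, fun r hr => ⟨?_, ?_, fun a ha har => key r hr a ha har⟩⟩
  · have h1 := (hc r ⟨hr.1.le, hr.2⟩).1
    have := (hh.R_pos hr).le
    have : 0 ≤ c * (r + h r) ^ 3 := by positivity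
    linarith
  · have hR := (hh.R_pos hr).le
    rcases lt_or_ge r (1/10) with h1 | h1
    · rw [(hh.small hr.1 h1).2.2]; simp; positivity
    · have h2 := (key r hr (1/20) (by norm_num) (by linarith)).2
      rw [(hh.small (r := 1/20) (by norm_num) (by norm_num)).2.2, sub_zero] at h2
      refine h2.trans ?_
      have := hr.2
      have : 2 * c * (r - 1/20) ≤ 2 * c * 1 := by gcongr; linarith
      have := mul_le_mul_of_nonneg_right this (sq_nonneg (r + h r))
      linarith

lemma GoodH.tendsto_R (hh : GoodH h) :
    Tendsto (fun r => r + h r) (nhdsWithin (1/2 : ℝ) (Iio (1/2 : ℝ))) atTop := by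
  have h1 := hh.2.2.2.1
  refine tendsto_atTop_mono' _ ?_ h1
  have : Ioo (0:ℝ) (1/2) ∈ nhdsWithin (1/2 : ℝ) (Iio (1/2 : ℝ)) := Ioo_mem_nhdsLT (by norm_num)
  filter_upwards [this] with r hr
  linarith [hr.1]

/-- eventually near `1/2` -/
lemma GoodH.limit (hh : GoodH h) {ε : ℝ} (hε : 0 < ε) :
    ∀ᶠ r in nhdsWithin (1/2 : ℝ) (Iio (1/2 : ℝ)), (deriv h r) ^ 2 ≤ ε * (r + h r) ^ 3 ∧
      |deriv (deriv h) r| ≤ ε * (r + h r) ^ 2 ∧ 1 / (r + h r) ≤ ε := by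
  obtain ⟨c, hc0, hc⟩ := hh.growth
  obtain ⟨a, ha, hac⟩ : ∃ a ∈ Ioo (0:ℝ) (1/2), c * (1/2 - a) ≤ ε / 2 := by
    refine ⟨1/2 - min (1/4) (ε / (2 * (c + 1))), ⟨?_, ?_⟩, ?_⟩
    · have := min_le_left (1/4) (ε / (2 * (c + 1))); linarith
    · have : 0 < min (1/4) (ε / (2 * (c + 1))) := by positivity
      linarith
    · have h1 := min_le_right (1/4) (ε / (2 * (c + 1)))
      calc _ = c * min (1/4) (ε / (2 * (c + 1))) := by ring
        _ ≤ (c + 1) * (ε / (2 * (c + 1))) := by gcongr; linarith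
        _ = ε / 2 := by field_simp
  have hR := hh.tendsto_R
  set Mx := max 1 (max (1 / ε) (max ((deriv h a) ^ 2 * (2 / ε)) (|deriv (deriv h) a| * (2 / ε))))
  have : Ioo a (1/2) ∈ nhdsWithin (1/2 : ℝ) (Iio (1/2 : ℝ)) := Ioo_mem_nhdsLT ha.2
  filter_upwards [this, hR.eventually_ge_atTop Mx] with r hr hM
  have hr' : r ∈ Ioo (0:ℝ) (1/2) := ⟨ha.1.trans hr.1, hr.2⟩
  obtain ⟨-, -, h3⟩ := hc r hr'
  obtain ⟨h4, h5⟩ := h3 a ha hr.1.le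
  have m1 : 1 ≤ r + h r := (le_max_left _ _).trans hM
  have m2 : 1 / ε ≤ r + h r := (le_max_left _ _).trans ((le_max_right _ _).trans hM)
  have m3 : (deriv h a) ^ 2 * (2 / ε) ≤ r + h r := (le_max_left _ _).trans
    ((le_max_right _ _).trans ((le_max_right _ _).trans hM))
  have m4 : |deriv (deriv h) a| * (2 / ε) ≤ r + h r := (le_max_right _ _).trans
    ((le_max_right _ _).trans ((le_max_right _ _).trans hM))
  set R := r + h r
  have R0 : 0 < R := by linarith
  have p2 : R ≤ R ^ 2 := le_self_pow₀ m1 (by norm_num)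
  have p3 : R ≤ R ^ 3 := le_self_pow₀ m1 (by norm_num)
  have k : c * (r - a) ≤ ε / 2 := by
    have : c * (r - a) ≤ c * (1/2 - a) := by gcongr; exact hr.2.le
    linarith
  have m3' : (deriv h a) ^ 2 ≤ ε / 2 * R := by
    have := mul_le_mul_of_nonneg_right m3 (by positivity : 0 ≤ ε / 2)
    have e : (deriv h a) ^ 2 * (2 / ε) * (ε / 2) = (deriv h a) ^ 2 := by field_simp
    linarith
  have m4' : |deriv (deriv h) a| ≤ ε / 2 * R := by
    have := mul_le_mul_of_nonneg_right m4 (by positivity : 0 ≤ ε / 2)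
    have e : |deriv (deriv h) a| * (2 / ε) * (ε / 2) = |deriv (deriv h) a| := by field_simp
    linarith
  refine ⟨?_, ?_, ?_⟩
  · have : c * (r - a) * R ^ 3 ≤ ε / 2 * R ^ 3 := by gcongr
    have : ε / 2 * R ≤ ε / 2 * R ^ 3 := by gcongr
    linarith
  · have : c * (r - a) * R ^ 2 ≤ ε / 2 * R ^ 2 := by gcongr
    have : ε / 2 * R ≤ ε / 2 * R ^ 2 := by gcongr
    have := abs_sub_abs_le_abs_sub (deriv (deriv h) r) (deriv (deriv h) a)
    linarith
  · rw [div_le_iff₀ R0]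
    rw [div_le_iff₀ hε] at m2
    linarith

end hfacts

/-! ### Facts about `Θ` -/

/-- all standing hypotheses on `h, r₀, Θ` -/
structure Setup (h : ℝ → ℝ) (r₀ : ℝ) (Θ : ℝ → ℝ) : Prop where
  hh : GoodH h
  hr₀ : r₀ ∈ Set.Ioo (0:ℝ) (1/2)
  hr₀eq : 2 * r₀ * h r₀ + r₀ ^ 2 = 1/4
  hΘ : GoodTheta h r₀ Θ

namespace Setup
variable {h : ℝ → ℝ} {r₀ : ℝ} {Θ : ℝ → ℝ}

lemma h0_pos (S : Setup h r₀ Θ) : 0 < h r₀ := by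
  have := S.hr₀eq
  have h1 := S.hr₀.1
  have h2 := S.hr₀.2
  by_contra hc
  push Not at hc
  nlinarith

lemma R0_gt (S : Setup h r₀ Θ) : 1/2 < r₀ + h r₀ := by
  have := S.hr₀eq
  have h1 := S.hr₀.1
  have h2 := S.h0_pos
  nlinarith

lemma R_gt (S : Setup h r₀ Θ) {r : ℝ} (hr : r ∈ Ioo (0:ℝ) (1/2)) (h0 : r₀ ≤ r) :
    r₀ + h r₀ ≤ r + h r := add_le_add h0 (S.hh.mono S.hr₀ hr h0)

lemma near (S : Setup h r₀ Θ) {r : ℝ} (hr : r ∈ Ioo (0:ℝ) (1/2)) (h0 : r ≤ r₀) :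
    0 < Θ r ∧ Θ r ≤ Real.pi / 2 ∧ (r + h r) * Real.cos (Θ r) = h r := by
  have hR := S.hh.R_pos hr
  have hn := S.hh.nonneg hr
  rw [S.hΘ.1 r hr.1 h0, add_comm (h r) r]
  have a1 : 0 ≤ h r / (r + h r) := by positivity
  have a2 : h r / (r + h r) < 1 := by rw [div_lt_one hR]; linarith [hr.1]
  refine ⟨Real.arccos_pos.2 a2, Real.arccos_le_pi_div_two.2 a1, ?_⟩
  rw [Real.cos_arccos (by linarith) a2.le]
  field_simp

lemma far_arg (S : Setup h r₀ Θ) {r : ℝ} (hr : r ∈ Ioo (0:ℝ) (1/2)) (h0 : r₀ < r) :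
    0 < 1 / (2 * (h r + r)) ∧ 1 / (2 * (h r + r)) < 1 := by
  have h1 := S.R0_gt
  have h2 := S.R_gt hr h0.le
  have : 0 < 2 * (h r + r) := by linarith
  refine ⟨by positivity, ?_⟩
  rw [div_lt_one this]
  linarith

lemma far (S : Setup h r₀ Θ) {r : ℝ} (hr : r ∈ Ioo (0:ℝ) (1/2)) (h0 : r₀ < r) :
    0 < Θ r ∧ Θ r < Real.pi / 2 ∧ (r + h r) * Real.sin (Θ r) = 1 / 2 := by
  have hR := S.hh.R_pos hr
  obtain ⟨a1, a2⟩ := S.far_arg hr h0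
  rw [S.hΘ.2 r h0 hr.2]
  refine ⟨Real.arcsin_pos.2 a1, Real.arcsin_lt_pi_div_two.2 a2, ?_⟩
  rw [Real.sin_arcsin (by linarith) a2.le, add_comm (h r) r]
  field_simp

lemma Θ_pos (S : Setup h r₀ Θ) {r : ℝ} (hr : r ∈ Ioo (0:ℝ) (1/2)) : 0 < Θ r := by
  rcases le_or_gt r r₀ with h0 | h0
  · exact (S.near hr h0).1
  · exact (S.far hr h0).1

lemma Θ_le (S : Setup h r₀ Θ) {r : ℝ} (hr : r ∈ Ioo (0:ℝ) (1/2)) : Θ r ≤ Real.pi / 2 := by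
  rcases le_or_gt r r₀ with h0 | h0
  · exact (S.near hr h0).2.1
  · exact (S.far hr h0).2.1.le

lemma contDiffAt_Θ (S : Setup h r₀ Θ) {r : ℝ} (hr : r ∈ Ioo (0:ℝ) (1/2)) (hne : r ≠ r₀) :
    ContDiffAt ℝ 1 Θ r := by
  have hc : ContDiffAt ℝ 1 h r := (S.hh.contDiffAt hr).of_le (by norm_num)
  have hR := S.hh.R_pos hr
  have hn := S.hh.nonneg hr
  rcases lt_or_gt_of_ne hne with h0 | h0
  · have e : Θ =ᶠ[nhds r] fun r => Real.arccos (h r / (h r + r)) := by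
      filter_upwards [Ioo_mem_nhds hr.1 h0] with t ht
      exact S.hΘ.1 t ht.1 ht.2.le
    refine ContDiffAt.congr_of_eventuallyEq ?_ e
    have a1 : 0 ≤ h r / (h r + r) := by rw [add_comm]; positivity
    have a2 : h r / (h r + r) < 1 := by rw [add_comm, div_lt_one hR]; linarith [hr.1]
    have hne0 : h r + r ≠ 0 := by linarith
    have d : ContDiffAt ℝ 1 (fun r => h r / (h r + r)) r := hc.div (hc.add contDiffAt_id) hne0
    have m1 : h r / (h r + r) ≠ -1 := by linarith
    have d2 : ContDiffAt ℝ 1 Real.arccos ((fun r => h r / (h r + r)) r) :=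
      Real.contDiffAt_arccos m1 a2.ne
    exact ContDiffAt.comp (g := Real.arccos) r d2 d
  · have e : Θ =ᶠ[nhds r] fun r => Real.arcsin (1 / (2 * (h r + r))) := by
      filter_upwards [Ioo_mem_nhds h0 hr.2] with t ht
      exact S.hΘ.2 t ht.1 ht.2
    refine ContDiffAt.congr_of_eventuallyEq ?_ e
    obtain ⟨a1, a2⟩ := S.far_arg hr h0
    have hne0 : 2 * (h r + r) ≠ 0 := by linarith
    have d : ContDiffAt ℝ 1 (fun r => 1 / (2 * (h r + r))) r :=
      contDiffAt_const.div (contDiffAt_const.mul (hc.add contDiffAt_id)) hne0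
    have m1 : 1 / (2 * (h r + r)) ≠ -1 := by linarith
    have d2 : ContDiffAt ℝ 1 Real.arcsin ((fun r => 1 / (2 * (h r + r))) r) :=
      Real.contDiffAt_arcsin m1 a2.ne
    exact ContDiffAt.comp (g := Real.arcsin) r d2 d

lemma hasDerivAt_Θ (S : Setup h r₀ Θ) {r : ℝ} (hr : r ∈ Ioo (0:ℝ) (1/2)) (hne : r ≠ r₀) :
    HasDerivAt Θ (deriv Θ r) r :=
  ((S.contDiffAt_Θ hr hne).differentiableAt (by norm_num)).hasDerivAt

lemma near_deriv (S : Setup h r₀ Θ) {r : ℝ} (hr : r ∈ Ioo (0:ℝ) (1/2)) (h0 : r < r₀) :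
    (r + h r) * deriv Θ r * Real.sin (Θ r) = (1 + deriv h r) * Real.cos (Θ r) - deriv h r := by
  have d1 := (((hasDerivAt_id r).add (S.hh.hasDerivAt hr)).mul (S.hasDerivAt_Θ hr h0.ne).cos)
  have e : (fun r => (r + h r) * Real.cos (Θ r)) =ᶠ[nhds r] h := by
    filter_upwards [Ioo_mem_nhds hr.1 h0] with t ht
    exact (S.near ⟨ht.1, ht.2.trans S.hr₀.2⟩ ht.2.le).2.2
  have d2 := (S.hh.hasDerivAt hr).congr_of_eventuallyEq e
  have := d1.unique d2
  simp only [Pi.add_apply, id] at this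
  linarith

lemma far_deriv (S : Setup h r₀ Θ) {r : ℝ} (hr : r ∈ Ioo (0:ℝ) (1/2)) (h0 : r₀ < r) :
    (r + h r) * deriv Θ r * Real.cos (Θ r) = - ((1 + deriv h r) * Real.sin (Θ r)) := by
  have d1 := (((hasDerivAt_id r).add (S.hh.hasDerivAt hr)).mul (S.hasDerivAt_Θ hr h0.ne').sin)
  have e : (fun r => (r + h r) * Real.sin (Θ r)) =ᶠ[nhds r] fun _ => 1/2 := by
    filter_upwards [Ioo_mem_nhds h0 hr.2] with t ht
    exact (S.far ⟨S.hr₀.1.trans ht.1, ht.2⟩ ht.1).2.2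
  have d2 := (hasDerivAt_const r (1/2 : ℝ)).congr_of_eventuallyEq e
  have := d1.unique d2
  simp only [Pi.add_apply, id] at this
  linarith

lemma far_Θ_le (S : Setup h r₀ Θ) {r : ℝ} (hr : r ∈ Ioo (0:ℝ) (1/2)) (h0 : r₀ < r) :
    (r + h r) * Θ r ≤ 1 := by
  obtain ⟨a, b, c⟩ := S.far hr h0
  have h1 := Real.mul_le_sin a.le b.le
  have hR := S.hh.R_pos hr
  have h2 := mul_le_mul_of_nonneg_left h1 hR.le
  rw [c] at h2
  have hpi := Real.pi_le_four
  have hpi0 := Real.pi_pos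
  have : (r + h r) * Θ r = (r + h r) * (2 / Real.pi * Θ r) * (Real.pi / 2) := by field_simp
  rw [this]
  have h3 := mul_le_mul h2 (by linarith : Real.pi / 2 ≤ 2) (by positivity) (by norm_num)
  linarith

lemma far_cos (S : Setup h r₀ Θ) {r : ℝ} (hr : r ∈ Ioo (0:ℝ) (1/2)) (h0 : r₀ < r) :
    h r₀ / (r₀ + h r₀) ≤ Real.cos (Θ r) := by
  obtain ⟨a, b, c⟩ := S.far hr h0
  have hc : 0 ≤ Real.cos (Θ r) := Real.cos_nonneg_of_neg_pi_div_two_le_of_le (by linarith) b.le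
  have R0 := S.R0_gt
  have hle := S.R_gt hr h0.le
  refine le_of_sq_le_sq ?_ hc
  have hR0 : 0 < r₀ + h r₀ := by linarith
  have h1 : (h r₀ / (r₀ + h r₀)) ^ 2 = 1 - (1 / 2) ^ 2 / (r₀ + h r₀) ^ 2 := by
    have := S.hr₀eq
    field_simp
    linarith
  have h2 : Real.cos (Θ r) ^ 2 = 1 - (1 / 2) ^ 2 / (r + h r) ^ 2 := by
    have hR : 0 < r + h r := by linarith
    rw [← c, Real.cos_sq']
    field_simp
  rw [h1, h2]
  gcongr

end Setup

lemma EE_le {p q R Θ T M : ℝ} (hp : 0 ≤ p) (hΘ : 0 ≤ Θ) (hR : 0 < R) (hM : Θ ≤ M)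
    (h1 : p * Θ ^ 2 ≤ M) (h2 : p * Θ ^ 3 + p ^ 2 * Θ ^ 3 ≤ M) (h3 : R * |q| * Θ ^ 3 ≤ M)
    (h4 : |p * Wf p Θ + R * T * wf p Θ| ≤ M) :
    EE p q R Θ T ≤ M * (3 * (1 + M) ^ 2 + 9 + 3 * M) := by
  unfold EE E3
  have hM0 : 0 ≤ M := hΘ.trans hM
  calc _ ≤ 3 * (M * (1 + M)) * (1 + M) + (M * (2 + M) + M * (3 + M) + M) + M * (1 + M) + 2 * M := by
        gcongr
    _ = _ := by ring

/-- bound in the far regime -/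
def Mf (k η : ℝ) : ℝ :=
  2 * η + 2 * η ^ 2 + η + ((1 + 2 * η) * (2 * η ^ 2 * k) + 2 * η ^ 2 + η + (1 + 2 * η) * (η * k))
  + η

lemma EE_far {p q R Θ T k η : ℝ} (hp : 0 ≤ p) (hΘ : 0 < Θ) (hR : 0 < R) (hη : Θ ≤ η)
    (hn : p ^ 2 * Θ ^ 3 ≤ η) (hq : R * |q| * Θ ^ 3 ≤ η)
    (hT : R * T * Real.cos Θ = - ((1 + p) * Real.sin Θ)) (hk : 0 < k) (hck : 1 / k ≤ Real.cos Θ) :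
    EE p q R Θ T ≤ Mf k η * (3 * (1 + Mf k η) ^ 2 + 9 + 3 * Mf k η) ∧ p * Θ ^ 2 ≤ 2 * η := by
  have hη0 : 0 ≤ η := hΘ.le.trans hη
  have hm : p * Θ ^ 2 ≤ 2 * η := by
    have h1 : 0 ≤ Θ * (p * Θ - 1) ^ 2 := by positivity
    nlinarith
  have hm3 : p * Θ ^ 3 ≤ 2 * η ^ 2 := by
    calc p * Θ ^ 3 = p * Θ ^ 2 * Θ := by ring
      _ ≤ 2 * η * η := by gcongr
      _ = _ := by ring
  have t1 : 0 ≤ (1 + 2 * η) * (2 * η ^ 2 * k) := by positivity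
  have t2 : 0 ≤ (1 + 2 * η) * (η * k) := by positivity
  have t3 : 0 ≤ η ^ 2 := by positivity
  refine ⟨EE_le hp hΘ.le hR ?_ ?_ ?_ ?_ ?_, hm⟩
  · unfold Mf; linarith
  · unfold Mf; linarith
  · unfold Mf; linarith
  · unfold Mf; linarith
  · have hc : 0 < Real.cos Θ := lt_of_lt_of_le (by positivity) hck
    set t := Real.sin Θ / Real.cos Θ with ht
    have tk : |t| ≤ Θ * k := by
      rw [ht, abs_div, abs_of_pos hc, div_le_iff₀ hc]
      have : |Real.sin Θ| ≤ Θ := by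
        have := Real.abs_sin_le_abs (x := Θ)
        rwa [abs_of_pos hΘ] at this
      rw [div_le_iff₀ hk] at hck
      calc _ ≤ Θ * 1 := by linarith
        _ ≤ Θ * (Real.cos Θ * k) := by gcongr
        _ = _ := by ring
    have hRT : R * T = - ((1 + p) * t) := by
      rw [ht, eq_comm, ← mul_right_cancel_iff_of_pos hc, hT]
      field_simp
    have e : p * Wf p Θ + R * T * wf p Θ =
        - (wf p Θ * (p * (1 - Real.cos Θ) * t)) - p * uf p Θ - wf p Θ * t := by
      rw [hRT]
      have : Real.sin Θ = t * Real.cos Θ := by rw [ht]; field_simp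
      unfold uf
      rw [this]; ring
    rw [e]
    have w0 := one_le_wf hp Θ
    have w1 := wf_le hp hΘ.le
    have w2 : |wf p Θ| ≤ 1 + 2 * η := by rw [abs_of_nonneg (by linarith)]; linarith
    have cc := one_sub_cos_le (abs_of_pos hΘ).le
    have cc0 : 0 ≤ 1 - Real.cos Θ := by linarith [Real.cos_le_one Θ]
    have i1 : |wf p Θ * (p * (1 - Real.cos Θ) * t)| ≤ (1 + 2 * η) * (2 * η ^ 2 * k) := by
      rw [abs_mul, abs_mul, abs_mul, abs_of_nonneg hp, abs_of_nonneg cc0]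
      calc _ ≤ (1 + 2 * η) * (p * (Θ ^ 2) * (Θ * k)) := by gcongr; nlinarith [sq_nonneg Θ]
        _ = (1 + 2 * η) * (p * Θ ^ 3 * k) := by ring
        _ ≤ _ := by gcongr
    have i2 : |p * uf p Θ| ≤ 2 * η ^ 2 + η := by
      rw [abs_mul, abs_of_nonneg hp]
      calc _ ≤ p * ((Θ ^ 2 + p * Θ ^ 2) * Θ) := by
            gcongr; exact uf_abs_le hp (abs_of_pos hΘ).le
        _ = p * Θ ^ 3 + p ^ 2 * Θ ^ 3 := by ring
        _ ≤ _ := by linarith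
    have i3 : |wf p Θ * t| ≤ (1 + 2 * η) * (η * k) := by
      rw [abs_mul]
      calc _ ≤ (1 + 2 * η) * (Θ * k) := by gcongr
        _ ≤ _ := by gcongr
    have j1 := abs_sub (- (wf p Θ * (p * (1 - Real.cos Θ) * t)) - p * uf p Θ) (wf p Θ * t)
    have j2 := abs_sub (- (wf p Θ * (p * (1 - Real.cos Θ) * t))) (p * uf p Θ)
    rw [abs_neg] at j2
    unfold Mf
    linarith

namespace Setup
variable {h : ℝ → ℝ} {r₀ : ℝ} {Θ : ℝ → ℝ}

lemma far_bound (S : Setup h r₀ Θ) {r η : ℝ} (hr : r ∈ Ioo (0:ℝ) (1/2)) (h0 : r₀ < r)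
    (h1 : (deriv h r) ^ 2 ≤ η * (r + h r) ^ 3) (h2 : |deriv (deriv h) r| ≤ η * (r + h r) ^ 2)
    (h3 : 1 / (r + h r) ≤ η) :
    EE (deriv h r) (deriv (deriv h) r) (r + h r) (Θ r) (deriv Θ r) ≤
      Mf ((r₀ + h r₀) / h r₀) η * (3 * (1 + Mf ((r₀ + h r₀) / h r₀) η) ^ 2 + 9
        + 3 * Mf ((r₀ + h r₀) / h r₀) η) ∧
    deriv h r * Θ r ^ 2 ≤ 2 * η ∧ Θ r ≤ η := by
  have hR := S.hh.R_pos hr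
  have hΘ := S.Θ_pos hr
  have hRΘ := S.far_Θ_le hr h0
  have hle : Θ r ≤ η := by
    refine le_trans ?_ h3
    rw [le_div_iff₀ hR]; linarith
  have hη0 : 0 ≤ η := hΘ.le.trans hle
  have hRT0 : 0 ≤ (r + h r) * Θ r := by positivity
  have c3 : ((r + h r) * Θ r) ^ 3 ≤ 1 := pow_le_one₀ hRT0 hRΘ
  have := EE_far (T := deriv Θ r) (q := deriv (deriv h) r) (η := η)
    (k := (r₀ + h r₀) / h r₀) (S.hh.deriv_nonneg hr) hΘ hR hle ?_ ?_ (S.far_deriv hr h0) ?_ ?_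
  · exact ⟨this.1, this.2, hle⟩
  · calc _ ≤ η * (r + h r) ^ 3 * Θ r ^ 3 := by gcongr
      _ = η * ((r + h r) * Θ r) ^ 3 := by ring
      _ ≤ η * 1 := by gcongr
      _ = η := mul_one _
  · calc _ ≤ (r + h r) * (η * (r + h r) ^ 2) * Θ r ^ 3 := by gcongr
      _ = η * ((r + h r) * Θ r) ^ 3 := by ring
      _ ≤ η * 1 := by gcongr
      _ = η := mul_one _
  · have := S.h0_pos
    have := S.hr₀.1
    positivity
  · have := S.far_cos hr h0
    rwa [one_div_div]

lemma near_bound (S : Setup h r₀ Θ) : ∃ C : ℝ, ∀ r ∈ Ioo (0:ℝ) (1/2), r < r₀ →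
    EE (deriv h r) (deriv (deriv h) r) (r + h r) (Θ r) (deriv Θ r) ≤ C := by
  obtain ⟨c, hc0, hc⟩ := S.hh.growth
  obtain ⟨R0, hR0⟩ : ∃ x, x = r₀ + h r₀ := ⟨_, rfl⟩
  have R0p : 0 < R0 := by have := S.R0_gt; rw [hR0]; linarith
  obtain ⟨P, hP⟩ : ∃ x, x = 1 + c * R0 ^ 3 := ⟨_, rfl⟩
  have P0 : 0 ≤ P := by rw [hP]; positivity
  obtain ⟨Tb, hTb⟩ : ∃ x, x = (1 + 2 * P) * (10 * R0) := ⟨_, rfl⟩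
  have Tb0 : 0 ≤ Tb := by rw [hTb]; positivity
  obtain ⟨M, hM⟩ : ∃ x, x = 2 + P * 2 ^ 2 + (P * 2 ^ 3 + P ^ 2 * 2 ^ 3) +
    R0 * (c * R0 ^ 2) * 2 ^ 3 +
    (P * (2 * (1 + P * 2 ^ 2)) + Tb * (1 + P * 2 ^ 2)) := ⟨_, rfl⟩
  refine ⟨M * (3 * (1 + M) ^ 2 + 9 + 3 * M), fun r hr h0 => ?_⟩
  have hR := S.hh.R_pos hr
  have hΘ := S.Θ_pos hr
  have hΘ2 : Θ r ≤ 2 := by have := S.Θ_le hr; linarith [Real.pi_le_four]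
  have hp := S.hh.deriv_nonneg hr
  obtain ⟨g1, g2, -⟩ := hc r hr
  have hRR : r + h r ≤ R0 := hR0 ▸ add_le_add h0.le (S.hh.mono hr S.hr₀ h0.le)
  have hpP : deriv h r ≤ P := by
    have : (deriv h r) ^ 2 ≤ c * R0 ^ 3 := g1.trans (by gcongr)
    nlinarith [sq_nonneg (deriv h r - 1)]
  have hqq : |deriv (deriv h) r| ≤ c * R0 ^ 2 := g2.trans (by gcongr)
  have hT : |(r + h r) * deriv Θ r| ≤ Tb := by
    have e := S.near_deriv hr h0
    have e2 := (S.near hr h0.le).2.2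
    rcases lt_or_ge r (1/10) with hs | hs
    · obtain ⟨z1, z2, -⟩ := S.hh.small hr.1 hs
      have cz : Real.cos (Θ r) = 0 := by
        rw [z1, add_zero] at e2
        rcases mul_eq_zero.1 e2 with h | h
        · linarith [hr.1]
        · exact h
      have sz : Real.sin (Θ r) ≠ 0 := by
        intro h
        have := Real.sin_sq_add_cos_sq (Θ r)
        rw [h, cz] at this; norm_num at this
      rw [cz, z2] at e
      have : (r + h r) * deriv Θ r = 0 := by
        have e' : ((r + h r) * deriv Θ r) * Real.sin (Θ r) = 0 := by rw [e]; ring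
        exact (mul_eq_zero.1 e').resolve_right sz
      rw [this, abs_zero]; exact Tb0
    · have s0 : 0 ≤ Real.sin (Θ r) :=
        Real.sin_nonneg_of_nonneg_of_le_pi hΘ.le (by linarith [S.Θ_le hr, Real.pi_pos])
      have hn := S.hh.nonneg hr
      have s1 : 1 / 10 ≤ (r + h r) * Real.sin (Θ r) := by
        refine le_of_sq_le_sq ?_ (by positivity)
        have : ((r + h r) * Real.sin (Θ r)) ^ 2 = (r + h r) ^ 2 - h r ^ 2 := by
          have e3 : h r ^ 2 = ((r + h r) * Real.cos (Θ r)) ^ 2 := by rw [e2]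
          have e4 := Real.sin_sq_add_cos_sq (Θ r)
          rw [e3]
          linear_combination (r + h r) ^ 2 * e4
        rw [this]
        nlinarith
      have s2 : 1 / 10 ≤ R0 * Real.sin (Θ r) := s1.trans (by gcongr)
      have b : |(r + h r) * deriv Θ r * Real.sin (Θ r)| ≤ 1 + 2 * P := by
        rw [e]
        have c1 := Real.neg_one_le_cos (Θ r)
        have c2 := Real.cos_le_one (Θ r)
        rw [abs_le]; constructor <;> nlinarith
      rw [abs_mul _ (Real.sin _), abs_of_nonneg s0] at b
      set x := |(r + h r) * deriv Θ r|
      have x0 : 0 ≤ x := abs_nonneg _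
      calc x = x * (1/10) * 10 := by ring
        _ ≤ x * (R0 * Real.sin (Θ r)) * 10 := by gcongr
        _ = (x * Real.sin (Θ r)) * (10 * R0) := by ring
        _ ≤ _ := by rw [hTb]; exact mul_le_mul_of_nonneg_right b (by positivity)
  have b1 : deriv h r * Θ r ^ 2 ≤ P * 2 ^ 2 := by gcongr
  have b2 : deriv h r * Θ r ^ 3 + deriv h r ^ 2 * Θ r ^ 3 ≤ P * 2 ^ 3 + P ^ 2 * 2 ^ 3 := by gcongr
  have b3 : (r + h r) * |deriv (deriv h) r| * Θ r ^ 3 ≤ R0 * (c * R0 ^ 2) * 2 ^ 3 := by gcongr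
  have b4 : |deriv h r * Wf (deriv h r) (Θ r) + (r + h r) * deriv Θ r * wf (deriv h r) (Θ r)| ≤
      P * (2 * (1 + P * 2 ^ 2)) + Tb * (1 + P * 2 ^ 2) := by
    refine (abs_add_le _ _).trans ?_
    have W0 : 0 ≤ Wf (deriv h r) (Θ r) := by
      have := Wf_mono hp hΘ.le
      rwa [Wf_zero] at this
    have w0 := one_le_wf hp (Θ r)
    rw [abs_mul _ (wf _ _), abs_of_nonneg (mul_nonneg hp W0), abs_of_nonneg (by linarith : 0 ≤ wf (deriv h r) (Θ r))]
    have i1 : Wf (deriv h r) (Θ r) ≤ 2 * (1 + P * 2 ^ 2) :=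
      (Wf_le hp hΘ.le).trans (by gcongr)
    have i2 : wf (deriv h r) (Θ r) ≤ 1 + P * 2 ^ 2 :=
      (wf_le hp hΘ.le).trans (by gcongr)
    gcongr
  have q1 : 0 ≤ P * 2 ^ 2 := by positivity
  have q2 : 0 ≤ P * 2 ^ 3 + P ^ 2 * 2 ^ 3 := by positivity
  have q3 : 0 ≤ R0 * (c * R0 ^ 2) * 2 ^ 3 := by positivity
  have q4 : 0 ≤ P * (2 * (1 + P * 2 ^ 2)) + Tb * (1 + P * 2 ^ 2) := by positivity
  refine EE_le hp hΘ.le hR ?_ ?_ ?_ ?_ ?_ <;> rw [hM] <;> linarith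

/-- the error function -/
def err (h Θ : ℝ → ℝ) (r : ℝ) : ℝ :=
  EE (deriv h r) (deriv (deriv h) r) (r + h r) (Θ r) (deriv Θ r)

lemma err_bdd (S : Setup h r₀ Θ) : ∃ C : ℝ, 0 < C ∧ ∀ r ∈ Ioo (0:ℝ) (1/2), r ≠ r₀ →
    err h Θ r ≤ C := by
  obtain ⟨C, hC⟩ := S.near_bound
  obtain ⟨c, hc0, hc⟩ := S.hh.growth
  set k := (r₀ + h r₀) / h r₀
  set η := max c 2
  refine ⟨max 1 (max C (Mf k η * (3 * (1 + Mf k η) ^ 2 + 9 + 3 * Mf k η))),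
    lt_max_of_lt_left one_pos, fun r hr hne => ?_⟩
  rcases lt_or_gt_of_ne hne with h0 | h0
  · exact (hC r hr h0).trans ((le_max_left _ _).trans (le_max_right _ _))
  · refine le_trans ?_ ((le_max_right _ _).trans (le_max_right _ _))
    obtain ⟨g1, g2, -⟩ := hc r hr
    have hR := S.hh.R_pos hr
    have hR' : 1 / 2 < r + h r := S.R0_gt.trans_le (S.R_gt hr h0.le)
    have hcη : c ≤ η := le_max_left _ _
    refine (S.far_bound (η := η) hr h0 (g1.trans (by gcongr)) (g2.trans (by gcongr)) ?_).1
    refine le_trans ?_ (le_max_right _ _)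
    rw [div_le_iff₀ hR]; linarith

lemma err_small (S : Setup h r₀ Θ) {ε : ℝ} (hε : 0 < ε) :
    ∃ b : ℝ, r₀ ≤ b ∧ b < 1/2 ∧ ∀ r ∈ Ioo b (1/2),
      err h Θ r ≤ ε ∧ Θ r ≤ ε ∧ deriv h r * Θ r ^ 2 ≤ ε := by
  set k := (r₀ + h r₀) / h r₀
  have hcont : Continuous (fun η : ℝ => Mf k η * (3 * (1 + Mf k η) ^ 2 + 9 + 3 * Mf k η)) := by
    unfold Mf; fun_prop
  have h0 : (fun η : ℝ => Mf k η * (3 * (1 + Mf k η) ^ 2 + 9 + 3 * Mf k η)) 0 < ε := by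
    simp [Mf, hε]
  have ev := hcont.continuousAt.eventually_lt continuousAt_const h0
  obtain ⟨t, ht, hball⟩ := Metric.eventually_nhds_iff.1 ev
  set η := min (t / 2) (ε / 2)
  have hη : 0 < η := by positivity
  have hηε : 2 * η ≤ ε := by have := min_le_right (t / 2) (ε / 2); linarith
  have hηt := hball (y := η) (by
    rw [Real.dist_eq, sub_zero, abs_of_pos hη]
    have := min_le_left (t / 2) (ε / 2); linarith)
  have L := S.hh.limit hη
  obtain ⟨b, hb, hsub⟩ := (mem_nhdsLT_iff_exists_Ioo_subset).1 L
  refine ⟨max r₀ b, le_max_left _ _, max_lt S.hr₀.2 hb, fun r hr => ?_⟩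
  have hr1 : r₀ < r := (le_max_left _ _).trans_lt hr.1
  obtain ⟨l1, l2, l3⟩ := hsub ⟨(le_max_right _ _).trans_lt hr.1, hr.2⟩
  obtain ⟨f1, f2, f3⟩ := S.far_bound ⟨S.hr₀.1.trans hr1, hr.2⟩ hr1 l1 l2 l3
  exact ⟨f1.trans hηt.le, by linarith, by linarith⟩

end Setup

/-! ### Explicit 2×2 maps and local inverses -/

/-- the linear map with the matrix `(a b; c d)` -/
def matL (a b c d : ℝ) : ℝ × ℝ →L[ℝ] ℝ × ℝ :=
  (a • ContinuousLinearMap.fst ℝ ℝ ℝ + b • ContinuousLinearMap.snd ℝ ℝ ℝ).prod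
    (c • ContinuousLinearMap.fst ℝ ℝ ℝ + d • ContinuousLinearMap.snd ℝ ℝ ℝ)

@[simp] lemma matL_apply (a b c d : ℝ) (v : ℝ × ℝ) :
    matL a b c d v = (a * v.1 + b * v.2, c * v.1 + d * v.2) := by
  simp [matL]

lemma matL_comp (a b c d a' b' c' d' : ℝ) :
    (matL a b c d).comp (matL a' b' c' d') =
      matL (a * a' + b * c') (a * b' + b * d') (c * a' + d * c') (c * b' + d * d') := by
  ext <;> simp

lemma matL_norm_sub_le (a b c d a' b' c' d' : ℝ) :
    ‖matL a b c d - matL a' b' c' d'‖ ≤ |a - a'| + |b - b'| + |c - c'| + |d - d'| := by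
  refine ContinuousLinearMap.opNorm_le_bound _ (by positivity) fun v => ?_
  have h1 : |v.1| ≤ ‖v‖ := norm_fst_le v
  have h2 : |v.2| ≤ ‖v‖ := norm_snd_le v
  have key : ∀ s t : ℝ, |s * v.1 + t * v.2| ≤ (|s| + |t|) * ‖v‖ := by
    intro s t
    refine (abs_add_le _ _).trans ?_
    rw [abs_mul, abs_mul]
    nlinarith [abs_nonneg s, abs_nonneg t]
  have e : (matL a b c d - matL a' b' c' d') v =
      ((a - a') * v.1 + (b - b') * v.2, (c - c') * v.1 + (d - d') * v.2) := by
    simp only [sub_apply, matL_apply, Prod.mk_sub_mk]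
    ext <;> simp <;> ring
  rw [e, Prod.norm_def]
  have k1 := key (a - a') (b - b')
  have k2 := key (c - c') (d - d')
  have n0 := norm_nonneg v
  have p1 := mul_nonneg (add_nonneg (abs_nonneg (a - a')) (abs_nonneg (b - b'))) n0
  have p2 := mul_nonneg (add_nonneg (abs_nonneg (c - c')) (abs_nonneg (d - d'))) n0
  refine max_le ?_ ?_ <;> rw [Real.norm_eq_abs] <;> linarith

lemma matL_hasFDerivAt {f₁ f₂ : ℝ × ℝ → ℝ} {f : ℝ × ℝ → ℝ × ℝ} {x : ℝ × ℝ} {a b c d : ℝ}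
    (h1 : HasFDerivAt f₁ (a • ContinuousLinearMap.fst ℝ ℝ ℝ + b • ContinuousLinearMap.snd ℝ ℝ ℝ) x)
    (h2 : HasFDerivAt f₂ (c • ContinuousLinearMap.fst ℝ ℝ ℝ + d • ContinuousLinearMap.snd ℝ ℝ ℝ) x)
    (hf : ∀ y, f y = (f₁ y, f₂ y)) :
    HasFDerivAt f (matL a b c d) x := by
  have : f = fun y => (f₁ y, f₂ y) := funext hf
  rw [this]
  exact h1.prodMk h2

/-- the equivalence given by an invertible matrix -/
def matE (a b c d : ℝ) (hd : a * d - b * c ≠ 0) : (ℝ × ℝ) ≃L[ℝ] (ℝ × ℝ) :=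
  ContinuousLinearEquiv.equivOfInverse (matL a b c d)
    (matL (d / (a * d - b * c)) (-b / (a * d - b * c)) (-c / (a * d - b * c))
      (a / (a * d - b * c)))
    (by
      intro v
      generalize hD : a * d - b * c = D at hd
      simp only [matL_apply]
      ext
      · simp only
        field_simp
        rw [← hD]; ring
      · simp only
        field_simp
        rw [← hD]; ring)
    (by
      intro v
      generalize hD : a * d - b * c = D at hd
      simp only [matL_apply]
      ext
      · simp only
        field_simp
        rw [← hD]; ring
      · simp only
        field_simp
        rw [← hD]; ring)

lemma local_inverse {f : ℝ × ℝ → ℝ × ℝ} {p : ℝ × ℝ} {a b c d : ℝ}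
    (hf : ContDiffAt ℝ 1 f p) (hf' : HasFDerivAt f (matL a b c d) p)
    (hd : a * d - b * c ≠ 0) :
    ∃ L : ℝ × ℝ → ℝ × ℝ, ContDiffAt ℝ 1 L (f p) ∧ L (f p) = p ∧
      (∀ᶠ y in nhds (f p), f (L y) = y) ∧
      HasFDerivAt L (matL (d / (a * d - b * c)) (-b / (a * d - b * c)) (-c / (a * d - b * c))
      (a / (a * d - b * c))) (f p) := by
  have hE : HasFDerivAt f (matE a b c d hd : ℝ × ℝ →L[ℝ] ℝ × ℝ) p := hf'
  have hs : HasStrictFDerivAt f (matE a b c d hd : ℝ × ℝ →L[ℝ] ℝ × ℝ) p :=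
    hf.hasStrictFDerivAt' hE one_ne_zero
  refine ⟨hs.localInverse f _ p, ?_, hs.localInverse_apply_image, hs.eventually_right_inverse, ?_⟩
  · exact hf.to_localInverse hE one_ne_zero
  · exact hs.to_localInverse.hasFDerivAt

/-! ### The parametrisation maps -/

/-- polar-type parametrisation -/
def Pm (h : ℝ → ℝ) (y : ℝ × ℝ) : ℝ × ℝ :=
  (1 / 2 + (y.1 + h y.1) * Real.sin y.2, (y.1 + h y.1) * Real.cos y.2 - h y.1)

/-- the map `(r, φ) ↦ (r, W_r(φ))` -/
def Qm (h : ℝ → ℝ) (y : ℝ × ℝ) : ℝ × ℝ := (y.1, Wf (deriv h y.1) y.2)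

/-- the map giving the value of `W` at the image angle -/
def Fm (h Θ : ℝ → ℝ) (δ σ : ℝ) (y : ℝ × ℝ) : ℝ × ℝ :=
  (y.1, (1 - σ * δ) * Wf (deriv h y.1) y.2 + δ * Wf (deriv h y.1) (Θ y.1))

lemma fst_comp {f : ℝ → ℝ} {f' : ℝ} {y : ℝ × ℝ} (hf : HasDerivAt f f' y.1) :
    HasFDerivAt (fun z : ℝ × ℝ => f z.1) (f' • ContinuousLinearMap.fst ℝ ℝ ℝ) y :=
  hf.comp_hasFDerivAt y hasFDerivAt_fst

lemma snd_comp {f : ℝ → ℝ} {f' : ℝ} {y : ℝ × ℝ} (hf : HasDerivAt f f' y.2) :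
    HasFDerivAt (fun z : ℝ × ℝ => f z.2) (f' • ContinuousLinearMap.snd ℝ ℝ ℝ) y :=
  hf.comp_hasFDerivAt y hasFDerivAt_snd

lemma fst_cd {f : ℝ → ℝ} {y : ℝ × ℝ} (hf : ContDiffAt ℝ 1 f y.1) :
    ContDiffAt ℝ 1 (fun z : ℝ × ℝ => f z.1) y :=
  ContDiffAt.comp (g := f) (f := Prod.fst) y hf contDiffAt_fst

section
variable {h : ℝ → ℝ} {r₀ : ℝ} {Θ : ℝ → ℝ}

lemma Pm_contDiffAt (hh : GoodH h) {y : ℝ × ℝ} (hr : y.1 ∈ Ioo (0:ℝ) (1/2)) :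
    ContDiffAt ℝ 1 (Pm h) y := by
  have h1 : ContDiffAt ℝ 1 (fun z : ℝ × ℝ => h z.1) y :=
    fst_cd ((hh.contDiffAt hr).of_le (by norm_num))
  unfold Pm
  have s : ContDiffAt ℝ 1 (fun z : ℝ × ℝ => Real.sin z.2) y := contDiffAt_snd.sin
  have c : ContDiffAt ℝ 1 (fun z : ℝ × ℝ => Real.cos z.2) y := contDiffAt_snd.cos
  exact (contDiffAt_const.add ((contDiffAt_fst.add h1).mul s)).prodMk
    (((contDiffAt_fst.add h1).mul c).sub h1)

lemma Pm_hasFDerivAt (hh : GoodH h) {y : ℝ × ℝ} (hr : y.1 ∈ Ioo (0:ℝ) (1/2)) :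
    HasFDerivAt (Pm h) (matL ((1 + deriv h y.1) * Real.sin y.2) ((y.1 + h y.1) * Real.cos y.2)
      ((1 + deriv h y.1) * Real.cos y.2 - deriv h y.1) (-((y.1 + h y.1) * Real.sin y.2))) y := by
  have h1 := fst_comp (hh.hasDerivAt hr)
  have i1 := fst_comp (hasDerivAt_id y.1)
  have s := snd_comp (Real.hasDerivAt_sin y.2)
  have c := snd_comp (Real.hasDerivAt_cos y.2)
  refine matL_hasFDerivAt
    (f₁ := fun z => 1 / 2 + (z.1 + h z.1) * Real.sin z.2)
    (f₂ := fun z => (z.1 + h z.1) * Real.cos z.2 - h z.1) ?_ ?_ (fun z => rfl)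
  · refine (((i1.add h1).mul s).const_add (1 / 2)).congr_fderiv ?_
    ext <;> simp; ring
  · refine (((i1.add h1).mul c).sub h1).congr_fderiv ?_
    ext <;> simp; ring

lemma Wf_cd (hh : GoodH h) {y : ℝ × ℝ} (hr : y.1 ∈ Ioo (0:ℝ) (1/2)) {f : ℝ × ℝ → ℝ}
    (hf : ContDiffAt ℝ 1 f y) : ContDiffAt ℝ 1 (fun z : ℝ × ℝ => Wf (deriv h z.1) (f z)) y := by
  have h1 : ContDiffAt ℝ 1 (fun z : ℝ × ℝ => deriv h z.1) y :=
    fst_cd ((hh.contDiffAt1 hr).of_le (by norm_num))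
  unfold Wf
  exact ((contDiffAt_const.add h1).mul hf).sub (h1.mul hf.sin)

lemma Wf_fd (hh : GoodH h) {y : ℝ × ℝ} (hr : y.1 ∈ Ioo (0:ℝ) (1/2)) {f : ℝ × ℝ → ℝ} {a b : ℝ}
    (hf : HasFDerivAt f (a • ContinuousLinearMap.fst ℝ ℝ ℝ + b • ContinuousLinearMap.snd ℝ ℝ ℝ) y) :
    HasFDerivAt (fun z : ℝ × ℝ => Wf (deriv h z.1) (f z))
      ((deriv (deriv h) y.1 * sf (f y) + wf (deriv h y.1) (f y) * a) •
        ContinuousLinearMap.fst ℝ ℝ ℝ +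
        (wf (deriv h y.1) (f y) * b) • ContinuousLinearMap.snd ℝ ℝ ℝ) y := by
  have h1 := fst_comp (hh.hasDerivAt1 hr)
  unfold Wf
  refine (((h1.const_add 1).mul hf).sub (h1.mul hf.sin)).congr_fderiv ?_
  ext <;> simp [wf, sf] <;> ring

lemma Qm_contDiffAt (hh : GoodH h) {y : ℝ × ℝ} (hr : y.1 ∈ Ioo (0:ℝ) (1/2)) :
    ContDiffAt ℝ 1 (Qm h) y := by
  unfold Qm
  exact contDiffAt_fst.prodMk (Wf_cd hh hr contDiffAt_snd)

lemma Qm_hasFDerivAt (hh : GoodH h) {y : ℝ × ℝ} (hr : y.1 ∈ Ioo (0:ℝ) (1/2)) :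
    HasFDerivAt (Qm h) (matL 1 0 (deriv (deriv h) y.1 * sf y.2) (wf (deriv h y.1) y.2)) y := by
  refine matL_hasFDerivAt (f₁ := fun z => z.1) (f₂ := fun z => Wf (deriv h z.1) z.2) ?_ ?_
    (fun z => rfl)
  · exact hasFDerivAt_fst.congr_fderiv (by ext <;> simp)
  · have : HasFDerivAt (fun z : ℝ × ℝ => z.2) ((0:ℝ) • ContinuousLinearMap.fst ℝ ℝ ℝ +
        (1:ℝ) • ContinuousLinearMap.snd ℝ ℝ ℝ) y :=
      hasFDerivAt_snd.congr_fderiv (by ext <;> simp)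
    exact (Wf_fd hh hr this).congr_fderiv (by ext <;> simp)

lemma Fm_contDiffAt (S : Setup h r₀ Θ) {y : ℝ × ℝ} (hr : y.1 ∈ Ioo (0:ℝ) (1/2)) (hne : y.1 ≠ r₀)
    (δ σ : ℝ) : ContDiffAt ℝ 1 (Fm h Θ δ σ) y := by
  unfold Fm
  exact contDiffAt_fst.prodMk ((contDiffAt_const.mul (Wf_cd S.hh hr contDiffAt_snd)).add
    (contDiffAt_const.mul (Wf_cd S.hh hr (fst_cd (S.contDiffAt_Θ hr hne)))))

lemma Fm_hasFDerivAt (S : Setup h r₀ Θ) {y : ℝ × ℝ} (hr : y.1 ∈ Ioo (0:ℝ) (1/2)) (hne : y.1 ≠ r₀)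
    (δ σ : ℝ) : HasFDerivAt (Fm h Θ δ σ) (matL 1 0
      ((1 - σ * δ) * (deriv (deriv h) y.1 * sf y.2) + δ * (deriv (deriv h) y.1 * sf (Θ y.1)
        + wf (deriv h y.1) (Θ y.1) * deriv Θ y.1))
      ((1 - σ * δ) * wf (deriv h y.1) y.2)) y := by
  refine matL_hasFDerivAt (f₁ := fun z => z.1) (f₂ := fun z =>
    (1 - σ * δ) * Wf (deriv h z.1) z.2 + δ * Wf (deriv h z.1) (Θ z.1)) ?_ ?_
    (fun z => rfl)
  · exact hasFDerivAt_fst.congr_fderiv (by ext <;> simp)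
  · have t1 : HasFDerivAt (fun z : ℝ × ℝ => z.2) ((0:ℝ) • ContinuousLinearMap.fst ℝ ℝ ℝ +
        (1:ℝ) • ContinuousLinearMap.snd ℝ ℝ ℝ) y :=
      hasFDerivAt_snd.congr_fderiv (by ext <;> simp)
    have t2 : HasFDerivAt (fun z : ℝ × ℝ => Θ z.1) (deriv Θ y.1 • ContinuousLinearMap.fst ℝ ℝ ℝ +
        (0:ℝ) • ContinuousLinearMap.snd ℝ ℝ ℝ) y :=
      (fst_comp (S.hasDerivAt_Θ hr hne)).congr_fderiv (by ext <;> simp)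
    exact (((Wf_fd S.hh hr t1).const_mul (1 - σ * δ)).add
      ((Wf_fd S.hh hr t2).const_mul δ)).congr_fderiv (by ext <;> simp)

/-- the composition, as a matrix identity -/
lemma jac_id {p R s c S C w w' a n : ℝ} (hR : R ≠ 0) (hw0 : w ≠ 0) (hw : w = 1 + p - p * c)
    (hw' : w' = 1 + p - p * C) (h1 : s ^ 2 + c ^ 2 = 1) (h2 : S ^ 2 + C ^ 2 = 1) :
    (matL ((1 + p) * S) (R * C) ((1 + p) * C - p) (-(R * S))).comp
      ((matL 1 0 n a).comp
        (matL (s / w) (c / w) (((1 + p) * c - p) / (R * w)) (-((1 + p) * s) / (R * w)))) =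
    matL (s * S * (w' / w) + ((p * S - p * a * s + R * n) / w * s + a * c) * C)
      (c * S * (w' / w) + ((p * S - p * a * s + R * n) / w * c - a * s) * C)
      (s * C * (w' / w) - ((p * S - p * a * s + R * n) / w * s + a * c) * S)
      (c * C * (w' / w) - ((p * S - p * a * s + R * n) / w * c - a * s) * S) := by
  obtain ⟨u, hu⟩ : ∃ u, u = w⁻¹ := ⟨_, rfl⟩
  obtain ⟨v, hv⟩ : ∃ v, v = R⁻¹ := ⟨_, rfl⟩
  have e1 : w * u = 1 := by rw [hu]; field_simp
  have e2 : R * v = 1 := by rw [hv]; field_simp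
  rw [matL_comp, matL_comp]
  simp only [div_eq_mul_inv, mul_inv, ← hu, ← hv]
  rw [hw'] 
  rw [hw] at e1
  congr 1
  · linear_combination C * a * ((1 + p) * c - p) * u * e2 + a * C * u * p * h1 + a * C * c * e1
  · linear_combination -(C * a * (1 + p) * s * u) * e2 - a * C * s * e1
  · linear_combination s * u * p * h2 - S * a * ((1 + p) * c - p) * u * e2 - a * S * u * p * h1
      - a * S * c * e1
  · linear_combination c * u * p * h2 + S * a * (1 + p) * s * u * e2 + a * S * s * e1

end

/-! ### Points in the lower half -/

lemma integral_wgt (h Θ : ℝ → ℝ) (r a b : ℝ) (hΘ : Θ r ≠ 0) :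
    ∫ θ in a..b, wgt h Θ r θ =
      (Wf (deriv h r) (b * Θ r) - Wf (deriv h r) (a * Θ r)) / Θ r := by
  have hd : ∀ θ ∈ Set.uIcc a b,
      HasDerivAt (fun θ => Wf (deriv h r) (θ * Θ r) / Θ r) (wgt h Θ r θ) θ := by
    intro θ _
    have d1 : HasDerivAt (fun θ => θ * Θ r) (Θ r) θ := by
      simpa using (hasDerivAt_id θ).mul_const (Θ r)
    have d2 := ((hasDerivAt_Wf (deriv h r) (θ * Θ r)).comp θ d1).div_const (Θ r)
    refine d2.congr_deriv ?_
    unfold wgt wf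
    field_simp
  have hi : IntervalIntegrable (wgt h Θ r) MeasureTheory.volume a b := by
    apply Continuous.intervalIntegrable
    unfold wgt
    fun_prop
  rw [intervalIntegral.integral_eq_sub_of_hasDerivAt hd hi]
  ring

section
variable {h : ℝ → ℝ} {r₀ : ℝ} {Θ : ℝ → ℝ} {K : ℝ × ℝ → ℝ × ℝ} {δ : ℝ} {g : ℝ → ℝ → ℝ}
  {Ψ : ℝ × ℝ → ℝ × ℝ}

lemma mem_lowerDom {x : ℝ × ℝ} : x ∈ lowerDom ↔
    x.1 ∈ Icc (0:ℝ) 1 ∧ x.2 ∈ Ico (0:ℝ) (1/2) ∧ x ≠ (1/2, 0) := by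
  simp [lowerDom, and_assoc]

/-- radius of a point -/
def rad (K : ℝ × ℝ → ℝ × ℝ) (x : ℝ × ℝ) : ℝ := (K x).1
/-- angle of a point -/
def ang (Θ : ℝ → ℝ) (K : ℝ × ℝ → ℝ × ℝ) (x : ℝ × ℝ) : ℝ := (K x).2 * Θ (K x).1
/-- image angle of a point -/
def iang (Θ : ℝ → ℝ) (K : ℝ × ℝ → ℝ × ℝ) (g : ℝ → ℝ → ℝ) (x : ℝ × ℝ) : ℝ :=
  g (K x).1 (K x).2 * Θ (K x).1

lemma rad_mem (hK : GoodK h Θ K) {x : ℝ × ℝ} (hx : x ∈ lowerDom) :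
    rad K x ∈ Ioo (0:ℝ) (1/2) := (hK.1.mapsTo hx).1

lemma ang_le (S : Setup h r₀ Θ) (hK : GoodK h Θ K) {x : ℝ × ℝ} (hx : x ∈ lowerDom) :
    |ang Θ K x| ≤ Θ (rad K x) := by
  have h1 := (hK.1.mapsTo hx).2
  have h2 := S.Θ_pos (rad_mem hK hx)
  unfold ang
  rw [abs_mul, abs_of_pos (show 0 < Θ (K x).1 from h2)]
  have : |(K x).2| ≤ 1 := abs_le.2 h1
  unfold rad at *
  nlinarith

lemma Pm_eq (hK : GoodK h Θ K) {x : ℝ × ℝ} (hx : x ∈ lowerDom) :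
    Pm h (rad K x, ang Θ K x) = x := by
  obtain ⟨h1, h2⟩ := hK.2 x hx
  unfold Pm rad ang
  ext
  · exact h1.symm
  · exact h2.symm

lemma iang_pt (S : Setup h r₀ Θ) (hK : GoodK h Θ K) (hδ : δ ∈ Ioo (-1:ℝ) 1)
    (hg : IsGFamily h Θ δ g) {x : ℝ × ℝ} (hx : x ∈ lowerDom) {σ : ℝ} (hσ : σ = 1 ∨ σ = -1)
    (hs : 0 ≤ σ * ang Θ K x) :
    Pt (deriv h (rad K x)) (Θ (rad K x)) (ang Θ K x) (iang Θ K g x) δ σ := by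
  have hr := rad_mem hK hx
  have hθ := (hK.1.mapsTo hx).2
  have hΘ := S.Θ_pos hr
  obtain ⟨-, g2, -, -, g5, g6⟩ := hg (rad K x) hr
  have gm := g2.mapsTo hθ
  have hΘ' : 0 < Θ (K x).1 := hΘ
  refine ⟨S.hh.deriv_nonneg hr, hΘ, ang_le S hK hx, ?_, abs_lt.2 hδ, hσ, hs, ?_⟩
  · unfold iang
    rw [abs_mul, abs_of_pos hΘ']
    have : |g (K x).1 (K x).2| ≤ 1 := abs_le.2 gm
    unfold rad
    nlinarith
  · rcases hσ with rfl | rfl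
    · have h0 : 0 ≤ (K x).2 := by
        unfold ang at hs
        by_contra hc
        push Not at hc
        nlinarith
      have e := g6 (K x).2 ⟨h0, hθ.2⟩
      rw [integral_wgt _ _ _ _ _ hΘ.ne', integral_wgt _ _ _ _ _ hΘ.ne'] at e
      field_simp at e
      unfold iang ang
      unfold rad at *
      simp only [mul_comm (Θ (K x).1)] at e ⊢
      linarith
    · have h0 : (K x).2 ≤ 0 := by
        unfold ang at hs
        by_contra hc
        push Not at hc
        nlinarith
      have e := g5 (K x).2 ⟨hθ.1, h0⟩
      rw [integral_wgt _ _ _ _ _ hΘ.ne', integral_wgt _ _ _ _ _ hΘ.ne'] at e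
      field_simp at e
      have en := Wf_neg (deriv h (rad K x)) (Θ (rad K x))
      rw [en] at e
      unfold iang ang
      unfold rad at *
      simp only [mul_comm (Θ (K x).1)] at e ⊢
      linarith

lemma Psi_eq (hK : GoodK h Θ K) (hΨ : IsPsi K δ g Ψ) {x : ℝ × ℝ} (hx : x ∈ lowerDom) :
    Ψ x = Pm h (rad K x, iang Θ K g x) := by
  obtain ⟨a, b, c⟩ := hΨ.1 x hx
  rw [← Pm_eq hK a]
  unfold rad ang iang
  rw [b, c]

lemma K_unique (S : Setup h r₀ Θ) (hK : GoodK h Θ K) {x : ℝ × ℝ} (hx : x ∈ lowerDom) {r φ : ℝ}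
    (hr : r ∈ Ioo (0:ℝ) (1/2)) (hP : Pm h (r, φ) = x) (h1 : r ≤ r₀ → |φ| ≤ Real.pi)
    (h2 : r₀ < r → |φ| ≤ Real.pi / 2) : rad K x = r ∧ ang Θ K x = φ := by
  have hΘ := S.Θ_pos hr
  have hR := S.hh.R_pos hr
  have hx' := mem_lowerDom.1 hx
  have e1 : x.1 = 1 / 2 + (r + h r) * Real.sin φ := by rw [← hP]; rfl
  have e2 : x.2 = (r + h r) * Real.cos φ - h r := by rw [← hP]; rfl
  have hle : |φ| ≤ Θ r := by
    rcases le_or_gt r r₀ with h0 | h0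
    · obtain ⟨a, b, c⟩ := S.near hr h0
      by_contra hc
      push Not at hc
      have := Real.cos_lt_cos_of_nonneg_of_le_pi a.le (h1 h0) hc
      rw [Real.cos_abs] at this
      have h3 := mul_lt_mul_of_pos_left this hR
      linarith [hx'.2.1.1]
    · obtain ⟨a, b, c⟩ := S.far hr h0
      by_contra hc
      push Not at hc
      have h3 := Real.sin_lt_sin_of_lt_of_le_pi_div_two (by linarith [Real.pi_pos]) (h2 h0) hc
      have h4 := mul_lt_mul_of_pos_left h3 hR
      have i1 := hx'.1.1
      have i2 := hx'.1.2
      rcases abs_cases φ with ⟨hh, _⟩ | ⟨hh, _⟩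
      · rw [hh] at h4; linarith
      · rw [hh, Real.sin_neg] at h4; linarith
  have hmem : (r, φ / Θ r) ∈ Ioo (0:ℝ) (1/2) ×ˢ Icc (-1:ℝ) 1 := by
    refine ⟨hr, ?_⟩
    have := abs_le.1 hle
    constructor
    · rw [le_div_iff₀ hΘ]; linarith
    · rw [div_le_iff₀ hΘ]; linarith
  obtain ⟨y, hy, hKy⟩ := hK.1.surjOn hmem
  have ey := Pm_eq hK hy
  have a1 : rad K y = r := by unfold rad; rw [hKy]
  have a2 : ang Θ K y = φ := by unfold ang; rw [hKy]; simp only; field_simp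
  have : y = x := by rw [← ey, a1, a2, hP]
  rw [← this]
  exact ⟨a1, a2⟩

lemma ang_sign (S : Setup h r₀ Θ) (hK : GoodK h Θ K) {x : ℝ × ℝ} (hx : x ∈ lowerDom) {σ : ℝ}
    (hσ : σ = 1 ∨ σ = -1) (hs : 0 < σ * (x.1 - 1 / 2)) : 0 < σ * ang Θ K x := by
  have hr := rad_mem hK hx
  have hR := S.hh.R_pos hr
  have e : x.1 = 1 / 2 + (rad K x + h (rad K x)) * Real.sin (ang Θ K x) := (hK.2 x hx).1
  have ha := abs_le.1 ((ang_le S hK hx).trans (S.Θ_le hr))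
  have hpi := Real.pi_pos
  rcases hσ with rfl | rfl
  · by_contra hc
    push Not at hc
    have := Real.sin_nonpos_of_nonpos_of_neg_pi_le (by linarith) (by linarith : -Real.pi ≤ ang Θ K x)
    nlinarith
  · by_contra hc
    push Not at hc
    have := Real.sin_nonneg_of_nonneg_of_le_pi (by linarith) (by linarith : ang Θ K x ≤ Real.pi)
    nlinarith

end

/-- the property of the derivative at a point -/
def Good (Ψ : ℝ × ℝ → ℝ × ℝ) (δ σ e : ℝ) (x : ℝ × ℝ) : Prop :=
  ∃ a b c d : ℝ, HasFDerivWithinAt Ψ (matL a b c d) unitSq x ∧ |a - (1 - σ * δ)| ≤ |δ| * e ∧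
    |b| ≤ |δ| * e ∧ |c| ≤ |δ| * e ∧ |d - 1| ≤ |δ| * e

section
variable {h : ℝ → ℝ} {r₀ : ℝ} {Θ : ℝ → ℝ} {K : ℝ × ℝ → ℝ × ℝ} {δ : ℝ} {g : ℝ → ℝ → ℝ}
  {Ψ : ℝ × ℝ → ℝ × ℝ}

lemma low_point (S : Setup h r₀ Θ) (hK : GoodK h Θ K) (hδ : δ ∈ Ioo (-1:ℝ) 1)
    (hg : IsGFamily h Θ δ g) (hΨ : IsPsi K δ g Ψ) {x : ℝ × ℝ} (hx : x ∈ lowerDom)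
    (hne : rad K x ≠ r₀) {σ : ℝ} (hσ : σ = 1 ∨ σ = -1) (hs : 0 < σ * (x.1 - 1 / 2)) :
    ContDiffWithinAt ℝ 1 Ψ unitSq x ∧ Good Ψ δ σ (Setup.err h Θ (rad K x)) x := by
  have hsa := ang_sign S hK hx hσ hs
  have PT := iang_pt S hK hδ hg hx hσ hsa.le
  have hPx := Pm_eq hK hx
  have hr := rad_mem hK hx
  have hle := ang_le S hK hx
  have hR := S.hh.R_pos hr
  have hp := S.hh.deriv_nonneg hr
  have hΨx := Psi_eq hK hΨ hx
  obtain ⟨r, hrr⟩ : ∃ r, r = rad K x := ⟨_, rfl⟩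
  obtain ⟨φ, hφ⟩ : ∃ φ, φ = ang Θ K x := ⟨_, rfl⟩
  obtain ⟨ψ, hψ⟩ : ∃ ψ, ψ = iang Θ K g x := ⟨_, rfl⟩
  rw [← hrr] at hr hR hp hne
  rw [← hrr, ← hφ] at hPx hle
  rw [← hφ] at hsa
  rw [← hrr, ← hφ, ← hψ] at PT
  rw [← hrr]
  have w1 : wf (deriv h r) φ ≠ 0 := by linarith [one_le_wf hp φ]
  have w2 : wf (deriv h r) ψ ≠ 0 := by linarith [one_le_wf hp ψ]
  have sc1 := Real.sin_sq_add_cos_sq φ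
  have sc2 := Real.sin_sq_add_cos_sq ψ
  -- local inverse of the parametrisation
  have dP := Pm_hasFDerivAt S.hh (y := (r, φ)) hr
  have detP : (1 + deriv h r) * Real.sin φ * -((r + h r) * Real.sin φ) -
      (r + h r) * Real.cos φ * ((1 + deriv h r) * Real.cos φ - deriv h r) =
      -((r + h r) * wf (deriv h r) φ) := by
    unfold wf; linear_combination -(r + h r) * (1 + deriv h r) * sc1
  have detP0 : -((r + h r) * wf (deriv h r) φ) ≠ 0 := neg_ne_zero.2 (mul_ne_zero hR.ne' w1)
  obtain ⟨LP, P1, P2, P3, P4⟩ := local_inverse (Pm_contDiffAt S.hh (y := (r, φ)) hr) dP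
    (by simp only; rw [detP]; exact detP0)
  simp only at P4
  rw [detP] at P4
  rw [hPx] at P1 P2 P3 P4
  have P4' : HasFDerivAt LP (matL (Real.sin φ / wf (deriv h r) φ) (Real.cos φ / wf (deriv h r) φ)
      (((1 + deriv h r) * Real.cos φ - deriv h r) / ((r + h r) * wf (deriv h r) φ))
      (-((1 + deriv h r) * Real.sin φ) / ((r + h r) * wf (deriv h r) φ))) x := by
    convert P4 using 2
    · rw [neg_div_neg_eq]; field_simp
    · rw [neg_div_neg_eq]; field_simp
    · rw [neg_div_neg_eq]
    · rw [div_neg, neg_div]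
  -- local inverse of Q
  have dQ := Qm_hasFDerivAt S.hh (y := (r, ψ)) hr
  obtain ⟨LQ, Q1, Q2, Q3, Q4⟩ := local_inverse (Qm_contDiffAt S.hh (y := (r, ψ)) hr) dQ
    (by simpa using w2)
  simp only [one_mul, zero_mul, sub_zero, neg_zero, zero_div] at Q4
  rw [div_self w2] at Q4
  have eQF : Qm h (r, ψ) = Fm h Θ δ σ (r, φ) := by
    unfold Qm Fm; simp only; rw [PT.hW]
  have F1 := Fm_contDiffAt S (y := (r, φ)) hr hne δ σ
  have F2 : HasFDerivAt (Fm h Θ δ σ) (matL 1 0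
      ((1 - σ * δ) * (deriv (deriv h) r * sf φ) + δ * (deriv (deriv h) r * sf (Θ r)
        + wf (deriv h r) (Θ r) * deriv Θ r))
      ((1 - σ * δ) * wf (deriv h r) φ)) (LP x) := by
    rw [P2]; exact Fm_hasFDerivAt S (y := (r, φ)) hr hne δ σ
  rw [← P2] at F1
  have FP1 : ContDiffAt ℝ 1 (fun y => Fm h Θ δ σ (LP y)) x := F1.comp x P1
  have FP2 := F2.comp x P4'
  have FPx : Fm h Θ δ σ (LP x) = Qm h (r, ψ) := by rw [P2, eQF]
  rw [← FPx] at Q1 Q2 Q3 Q4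
  have QFP1 : ContDiffAt ℝ 1 (fun y => LQ (Fm h Θ δ σ (LP y))) x :=
    ContDiffAt.comp (g := LQ) x Q1 FP1
  have QFP2 : HasFDerivAt (fun y => LQ (Fm h Θ δ σ (LP y))) _ x :=
    HasFDerivAt.comp (g := LQ) x Q4 FP2
  have dP' : HasFDerivAt (Pm h) (matL ((1 + deriv h r) * Real.sin ψ) ((r + h r) * Real.cos ψ)
      ((1 + deriv h r) * Real.cos ψ - deriv h r) (-((r + h r) * Real.sin ψ)))
      (LQ (Fm h Θ δ σ (LP x))) := by
    rw [Q2]; exact Pm_hasFDerivAt S.hh (y := (r, ψ)) hr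
  have cP' := Pm_contDiffAt S.hh (y := (r, ψ)) hr
  rw [← Q2] at cP'
  have G1 : ContDiffAt ℝ 1 (fun y => Pm h (LQ (Fm h Θ δ σ (LP y)))) x :=
    ContDiffAt.comp (g := Pm h) x cP' QFP1
  have G2 : HasFDerivAt (fun y => Pm h (LQ (Fm h Θ δ σ (LP y)))) _ x :=
    HasFDerivAt.comp (g := Pm h) x dP' QFP2
  have cont : Tendsto LP (nhds x) (nhds (r, φ)) := by
    have := P1.continuousAt.tendsto
    rwa [P2] at this
  have ev1 : ∀ᶠ y in nhds x, (LP y).1 ∈ Ioo (0:ℝ) (1/2) :=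
    (continuous_fst.continuousAt.tendsto.comp cont).eventually (isOpen_Ioo.mem_nhds hr)
  have ev2 : ∀ᶠ y in nhds x, 0 < σ * (LP y).2 := by
    have : ContinuousAt (fun z : ℝ × ℝ => σ * z.2) (r, φ) := by fun_prop
    exact (this.tendsto.comp cont).eventually (isOpen_Ioi.mem_nhds hsa)
  have ev3 : ∀ᶠ y in nhds x, ((LP y).1 ≤ r₀ → |(LP y).2| ≤ Real.pi) ∧
      (r₀ < (LP y).1 → |(LP y).2| ≤ Real.pi / 2) := by
    have ca : ContinuousAt (fun z : ℝ × ℝ => |z.2|) (r, φ) := by fun_prop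
    have cf : ContinuousAt (fun z : ℝ × ℝ => z.1) (r, φ) := by fun_prop
    have hpi := Real.pi_pos
    rcases lt_or_gt_of_ne hne with h0 | h0
    · have l1 : |φ| < Real.pi := by have := S.Θ_le hr; linarith
      filter_upwards [(ca.tendsto.comp cont).eventually (isOpen_Iio.mem_nhds l1),
        (cf.tendsto.comp cont).eventually (isOpen_Iio.mem_nhds h0)] with y y1 y2
      have y1' : |(LP y).2| < Real.pi := y1
      have y2' : (LP y).1 < r₀ := y2
      exact ⟨fun _ => y1'.le, fun hc => absurd hc (not_lt.2 y2'.le)⟩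
    · have l1 : |φ| < Real.pi / 2 := by have := (S.far hr h0).2.1; linarith
      filter_upwards [(ca.tendsto.comp cont).eventually (isOpen_Iio.mem_nhds l1)] with y y1
      have y1' : |(LP y).2| < Real.pi / 2 := y1
      exact ⟨fun _ => by linarith, fun _ => y1'.le⟩
  have hx' := mem_lowerDom.1 hx
  have ev4 : ∀ᶠ y in nhds x, y.2 < 1 / 2 ∧ y ≠ (1 / 2, 0) :=
    (continuous_snd.continuousAt.eventually_lt continuousAt_const hx'.2.1.2).and
      (isOpen_ne.mem_nhds hx'.2.2)
  have ev5 : ∀ᶠ y in nhds x, Qm h (LQ (Fm h Θ δ σ (LP y))) = Fm h Θ δ σ (LP y) :=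
    FP1.continuousAt.tendsto.eventually Q3
  have ev : Ψ =ᶠ[nhdsWithin x unitSq] fun y => Pm h (LQ (Fm h Θ δ σ (LP y))) := by
    filter_upwards [mem_nhdsWithin_of_mem_nhds ev1, mem_nhdsWithin_of_mem_nhds ev2,
      mem_nhdsWithin_of_mem_nhds ev3, mem_nhdsWithin_of_mem_nhds ev4,
      mem_nhdsWithin_of_mem_nhds ev5, mem_nhdsWithin_of_mem_nhds P3, self_mem_nhdsWithin]
      with y y1 y2 y3 y4 y5 y6 y7
    have y1' : (LP y).1 ∈ Ioo (0:ℝ) (1/2) := y1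
    have yl : y ∈ lowerDom := mem_lowerDom.2 ⟨y7.1, ⟨y7.2.1, y4.1⟩, y4.2⟩
    obtain ⟨k1, k2⟩ := K_unique S hK yl (r := (LP y).1) (φ := (LP y).2) y1' y6 y3.1 y3.2
    have pt := iang_pt S hK hδ hg yl hσ (by rw [k2]; exact le_of_lt y2)
    rw [Psi_eq hK hΨ yl]
    have y5' : Qm h (LQ (Fm h Θ δ σ (LP y))) = Fm h Θ δ σ (LP y) := y5
    have z1 : (LQ (Fm h Θ δ σ (LP y))).1 = (LP y).1 :=
      (congrArg Prod.fst y5' :)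
    have z2 : Wf (deriv h (LQ (Fm h Θ δ σ (LP y))).1) (LQ (Fm h Θ δ σ (LP y))).2 =
      (1 - σ * δ) * Wf (deriv h (LP y).1) (LP y).2 + δ * Wf (deriv h (LP y).1) (Θ (LP y).1) :=
      (congrArg Prod.snd y5' :)
    have hW := pt.hW
    rw [k1, k2, ← z2, z1] at hW
    have z3 := Wf_inj (S.hh.deriv_nonneg y1') hW
    rw [z3, k1, ← z1]
  have exx : x ∈ unitSq := ⟨hx'.1, hx'.2.1.1, by linarith [hx'.2.1.2]⟩
  refine ⟨G1.contDiffWithinAt.congr_of_eventuallyEq_of_mem ev exx, ?_⟩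
  have D := (G2.hasFDerivWithinAt (s := unitSq)).congr_of_eventuallyEq ev (ev.self_of_nhdsWithin exx)
  have aeq : (matL 1 0 (-(deriv (deriv h) r * sf ψ) / wf (deriv h r) ψ)
      (1 / wf (deriv h r) ψ)).comp (matL 1 0
      ((1 - σ * δ) * (deriv (deriv h) r * sf φ) + δ * (deriv (deriv h) r * sf (Θ r)
        + wf (deriv h r) (Θ r) * deriv Θ r))
      ((1 - σ * δ) * wf (deriv h r) φ)) = matL 1 0
      (Nf (deriv h r) (deriv (deriv h) r) (Θ r) (deriv Θ r) φ ψ δ σ / wf (deriv h r) ψ)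
      ((1 - σ * δ) * wf (deriv h r) φ / wf (deriv h r) ψ) := by
    rw [matL_comp]
    unfold Nf
    congr 1
    · ring
    · ring
    · field_simp; ring
    · field_simp; ring
  have key := jac_id (p := deriv h r) (R := r + h r) (s := Real.sin φ) (c := Real.cos φ)
    (S := Real.sin ψ) (C := Real.cos ψ) (w := wf (deriv h r) φ) (w' := wf (deriv h r) ψ)
    (a := (1 - σ * δ) * wf (deriv h r) φ / wf (deriv h r) ψ)
    (n := Nf (deriv h r) (deriv (deriv h) r) (Θ r) (deriv Θ r) φ ψ δ σ / wf (deriv h r) ψ)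
    hR.ne' w1 rfl rfl sc1 sc2
  have D' : HasFDerivWithinAt Ψ _ unitSq x := D.congr_fderiv
    ((by rw [← aeq, ContinuousLinearMap.comp_assoc] : _ = _).trans key)
  have ent := PT.entries (q := deriv (deriv h) r) (T := deriv Θ r) hR rfl rfl rfl
  refine ⟨_, _, _, _, D', ?_⟩
  simp only [Bf, mul_div_assoc] at ent ⊢
  exact ent

end

/-! ### Upper half and the middle line -/

/-- reflection in the line `x₂ = 1/2` -/
def rho (x : ℝ × ℝ) : ℝ × ℝ := (x.1, 1 - x.2)

lemma rho_hasFDerivAt (x : ℝ × ℝ) : HasFDerivAt rho (matL 1 0 0 (-1)) x := by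
  refine matL_hasFDerivAt (f₁ := fun z => z.1) (f₂ := fun z => 1 - z.2) ?_ ?_ (fun z => rfl)
  · exact hasFDerivAt_fst.congr_fderiv (by ext <;> simp)
  · exact (hasFDerivAt_snd.const_sub 1).congr_fderiv (by ext <;> simp)

lemma rho_contDiff : ContDiff ℝ 1 rho := by
  unfold rho
  exact contDiff_fst.prodMk (contDiff_const.sub contDiff_snd)

lemma rho_mapsTo : MapsTo rho unitSq unitSq := by
  rintro ⟨a, b⟩ ⟨h1, h2, h3⟩
  exact ⟨h1, by simp only [rho] at *; linarith, by simp only [rho] at *; linarith⟩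

section
variable {h : ℝ → ℝ} {r₀ : ℝ} {Θ : ℝ → ℝ} {K : ℝ × ℝ → ℝ × ℝ} {δ : ℝ} {g : ℝ → ℝ → ℝ}
  {Ψ : ℝ × ℝ → ℝ × ℝ}

lemma refl_good (hΨ : IsPsi K δ g Ψ) {x : ℝ × ℝ} (hx : x ∈ unitSq) (h2 : 1 / 2 < x.2)
    {σ e : ℝ} (hc : ContDiffWithinAt ℝ 1 Ψ unitSq (rho x)) (hG : Good Ψ δ σ e (rho x)) :
    ContDiffWithinAt ℝ 1 Ψ unitSq x ∧ Good Ψ δ σ e x := by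
  have ev : Ψ =ᶠ[nhdsWithin x unitSq] fun y => rho (Ψ (rho y)) := by
    have : ∀ᶠ y in nhds x, 1 / 2 < y.2 :=
      continuousAt_const.eventually_lt continuous_snd.continuousAt h2
    filter_upwards [mem_nhdsWithin_of_mem_nhds this, self_mem_nhdsWithin] with y y1 y2
    exact hΨ.2.2.1 y y2 y1
  constructor
  · have c1 : ContDiffWithinAt ℝ 1 (fun y => Ψ (rho y)) unitSq x :=
      ContDiffWithinAt.comp (g := Ψ) x hc rho_contDiff.contDiffWithinAt rho_mapsTo
    have c2 : ContDiffWithinAt ℝ 1 (fun y => rho (Ψ (rho y))) unitSq x :=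
      ContDiffAt.comp_contDiffWithinAt (g := rho) x rho_contDiff.contDiffAt c1
    exact c2.congr_of_eventuallyEq_of_mem ev hx
  · obtain ⟨a, b, c, d, hD, h1, h2, h3, h4⟩ := hG
    have d1 : HasFDerivWithinAt (fun y => Ψ (rho y)) _ unitSq x :=
      HasFDerivWithinAt.comp (g := Ψ) x hD (rho_hasFDerivAt x).hasFDerivWithinAt rho_mapsTo
    have d2 : HasFDerivWithinAt (fun y => rho (Ψ (rho y))) _ unitSq x :=
      HasFDerivAt.comp_hasFDerivWithinAt (g := rho) x (rho_hasFDerivAt _) d1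
    have d3 := d2.congr_of_eventuallyEq ev (ev.self_of_nhdsWithin hx)
    rw [matL_comp, matL_comp] at d3
    refine ⟨_, _, _, _, d3, ?_, ?_, ?_, ?_⟩
    · convert h1 using 3; ring
    · have : 1 * (a * 0 + b * -1) + 0 * (c * 0 + d * -1) = -b := by ring
      rw [this, abs_neg]; exact h2
    · have : 0 * (a * 1 + b * 0) + -1 * (c * 1 + d * 0) = -c := by ring
      rw [this, abs_neg]; exact h3
    · convert h4 using 3; ring

lemma le_rad (S : Setup h r₀ Θ) (hK : GoodK h Θ K) {x : ℝ × ℝ} (hx : x ∈ lowerDom) :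
    x.2 ≤ rad K x := by
  have e : x.2 = (rad K x + h (rad K x)) * Real.cos (ang Θ K x) - h (rad K x) := (hK.2 x hx).2
  have hR := S.hh.R_pos (rad_mem hK hx)
  have := Real.cos_le_one (ang Θ K x)
  nlinarith

lemma any_point (S : Setup h r₀ Θ) (hK : GoodK h Θ K) (hδ : δ ∈ Ioo (-1:ℝ) 1)
    (hg : IsGFamily h Θ δ g) (hΨ : IsPsi K δ g Ψ) {x : ℝ × ℝ} (hx : x ∈ unitSq)
    (hs : x ∉ seams r₀ K) (hne : x.2 ≠ 1 / 2) {σ : ℝ} (hσ : σ = 1 ∨ σ = -1)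
    (hsg : 0 < σ * (x.1 - 1 / 2)) :
    ∃ r ∈ Ioo (0:ℝ) (1/2), r ≠ r₀ ∧ (x.2 ≤ r ∨ 1 - x.2 ≤ r) ∧
      ContDiffWithinAt ℝ 1 Ψ unitSq x ∧ Good Ψ δ σ (Setup.err h Θ r) x := by
  have hx1 : x.1 ≠ 1 / 2 := by
    intro hc; rw [hc] at hsg; simp at hsg
  rcases lt_or_gt_of_ne hne with h0 | h0
  · have hl : x ∈ lowerDom := mem_lowerDom.2 ⟨hx.1, ⟨hx.2.1, h0⟩, fun hc => hx1 (by rw [hc])⟩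
    have hr : rad K x ≠ r₀ := fun hc => hs (Or.inl ⟨hl, hc⟩)
    exact ⟨rad K x, rad_mem hK hl, hr, Or.inl (le_rad S hK hl),
      low_point S hK hδ hg hΨ hl hr hσ hsg⟩
  · have hl : rho x ∈ lowerDom := mem_lowerDom.2 ⟨hx.1, ⟨(rho_mapsTo hx).2.1, by
      simp only [rho]; linarith⟩, fun hc => hx1 (congrArg Prod.fst hc :)⟩
    have hr : rad K (rho x) ≠ r₀ := fun hc => hs (Or.inr ⟨hl, hc⟩)
    obtain ⟨p1, p2⟩ := low_point S hK hδ hg hΨ hl hr hσ hsg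
    exact ⟨rad K (rho x), rad_mem hK hl, hr, Or.inr (le_rad S hK hl), refl_good hΨ hx h0 p1 p2⟩

lemma Psi_mid (hΨ : IsPsi K δ g Ψ) {x₁ : ℝ} (hx : x₁ ∈ Icc (0:ℝ) 1) {σ : ℝ} (hσ : σ = 1 ∨ σ = -1)
    (hsg : 0 < σ * (x₁ - 1 / 2)) :
    Ψ (x₁, 1 / 2) = (1 / 2 + (1 - σ * δ) * (x₁ - 1 / 2) + δ / 2, 1 / 2) := by
  rcases hσ with rfl | rfl
  · rw [hΨ.2.2.2.2 x₁ (by linarith) hx.2]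
    ext
    · simp only; ring
    · rfl
  · rw [hΨ.2.2.2.1 x₁ hx.1 (by linarith)]
    ext
    · simp only; ring
    · rfl

lemma vert_cont (S : Setup h r₀ Θ) (hK : GoodK h Θ K) (hδ : δ ∈ Ioo (-1:ℝ) 1)
    (hg : IsGFamily h Θ δ g) (hΨ : IsPsi K δ g Ψ) {x₁ : ℝ} (hx : x₁ ∈ Icc (0:ℝ) 1) {σ : ℝ}
    (hσ : σ = 1 ∨ σ = -1) (hsg : 0 < σ * (x₁ - 1 / 2)) :
    Tendsto (fun t => Ψ (x₁, t)) (nhdsWithin (1/2) (Iio (1/2))) (nhds (Ψ (x₁, 1 / 2))) := by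
  rw [Psi_mid hΨ hx hσ hsg, Metric.tendsto_nhds]
  intro ε hε
  obtain ⟨η, hη, hη1, hηε⟩ : ∃ η : ℝ, 0 < η ∧ η ≤ 1 ∧ 9 * η ≤ ε :=
    ⟨min 1 (ε / 9), by positivity, min_le_left _ _, by
      have := min_le_right 1 (ε / 9); linarith⟩
  obtain ⟨b, hb0, hb1, hb⟩ := S.err_small hη
  have hm : max b (1 / 2 - η) < 1 / 2 := max_lt hb1 (by linarith)
  filter_upwards [Ioo_mem_nhdsLT hm] with t ht
  have t1 : b < t := (le_max_left _ _).trans_lt ht.1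
  have t2 : 1 / 2 - η < t := (le_max_right _ _).trans_lt ht.1
  have t3 : t < 1 / 2 := ht.2
  have r0p := S.hr₀.1
  have hx1 : x₁ ≠ 1 / 2 := by
    intro hc; rw [hc] at hsg; simp at hsg
  have hl : (x₁, t) ∈ lowerDom :=
    mem_lowerDom.2 ⟨hx, ⟨by simp only; linarith, t3⟩, fun hc => hx1 (congrArg Prod.fst hc :)⟩
  have hr := rad_mem hK hl
  have hle := le_rad S hK hl
  have hsa := ang_sign S hK hl hσ hsg
  have PT := iang_pt S hK hδ hg hl hσ hsa.le
  have hP := Pm_eq hK hl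
  rw [Psi_eq hK hΨ hl]
  simp only at hle
  obtain ⟨r, hrr⟩ : ∃ r, r = rad K (x₁, t) := ⟨_, rfl⟩
  obtain ⟨φ, hφ⟩ : ∃ φ, φ = ang Θ K (x₁, t) := ⟨_, rfl⟩
  obtain ⟨ψ, hψ⟩ : ∃ ψ, ψ = iang Θ K g (x₁, t) := ⟨_, rfl⟩
  rw [← hrr] at hr hle
  rw [← hrr, ← hφ] at hP
  rw [← hrr, ← hφ, ← hψ] at PT
  rw [← hrr, ← hψ]
  obtain ⟨-, s1, s2⟩ := hb r ⟨by linarith, hr.2⟩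
  have hR := S.hh.R_pos hr
  have hfar : r₀ < r := by linarith
  have hRΘ := S.far_Θ_le hr hfar
  have hsin := (S.far hr hfar).2.2
  have e1 : x₁ - 1 / 2 = (r + h r) * Real.sin φ := by
    have : Pm h (r, φ) = (x₁, t) := hP
    have := congrArg Prod.fst this
    simp only [Pm] at this
    linarith
  have hΘ := PT.hΘ
  rw [Prod.dist_eq, max_lt_iff, Real.dist_eq, Real.dist_eq]
  have aσ := PT.hσ'
  have aδ := PT.hδ
  have hp := PT.hp
  constructor
  · have e2 : (Pm h (r, ψ)).1 - (1 / 2 + (1 - σ * δ) * (x₁ - 1 / 2) + δ / 2) =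
        -((r + h r) * (1 + deriv h r)) * (sf ψ - (1 - σ * δ) * sf φ - δ * sf (Θ r)) := by
      have hW := PT.hW
      simp only [Pm]
      rw [e1]
      unfold Wf at hW
      unfold sf
      linear_combination (r + h r) * hW + δ * hsin
    rw [e2, abs_mul, abs_neg, abs_of_nonneg (by positivity)]
    have f1 := sf_abs_le PT.hψ
    have f2 := sf_abs_le PT.hφ
    have f3 := sf_abs_le (abs_of_pos hΘ).le
    have c1 : |1 - σ * δ| ≤ 2 := by
      refine (abs_sub _ _).trans ?_
      rw [abs_one, abs_mul, aσ]; linarith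
    have g1 : |sf ψ - (1 - σ * δ) * sf φ - δ * sf (Θ r)| ≤ 4 * Θ r ^ 3 := by
      refine (abs_sub _ _).trans ?_
      have := abs_sub (sf ψ) ((1 - σ * δ) * sf φ)
      rw [abs_mul] at this
      rw [abs_mul]
      have m1 := mul_le_mul c1 f2 (abs_nonneg _) (by norm_num)
      have m2 := mul_le_mul aδ.le f3 (abs_nonneg _) (by norm_num)
      linarith
    calc _ ≤ (r + h r) * (1 + deriv h r) * (4 * Θ r ^ 3) := by gcongr
      _ = 4 * ((r + h r) * Θ r) * (Θ r ^ 2 + deriv h r * Θ r ^ 2) := by ring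
      _ ≤ 4 * 1 * (η + η) := by
          gcongr
          nlinarith
      _ < ε := by linarith
  · have cc := one_sub_cos_le PT.hψ
    have cc0 := Real.cos_le_one ψ
    have q : (r + h r) * (1 - Real.cos ψ) ≤ η := by
      have h1 : (r + h r) * (1 - Real.cos ψ) ≤ (r + h r) * Θ r ^ 2 := by
        apply mul_le_mul_of_nonneg_left _ hR.le
        nlinarith [sq_nonneg (Θ r)]
      have h2 : (r + h r) * Θ r ^ 2 = (r + h r) * Θ r * Θ r := by ring
      nlinarith
    have q0 : 0 ≤ (r + h r) * (1 - Real.cos ψ) := mul_nonneg hR.le (by linarith)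
    have e3 : (Pm h (r, ψ)).2 = r - (r + h r) * (1 - Real.cos ψ) := by simp only [Pm]; ring
    rw [e3, abs_lt]
    have := hr.2
    constructor <;> linarith

end

section
variable {h : ℝ → ℝ} {r₀ : ℝ} {Θ : ℝ → ℝ} {K : ℝ × ℝ → ℝ × ℝ} {δ : ℝ} {g : ℝ → ℝ → ℝ}
  {Ψ : ℝ × ℝ → ℝ × ℝ}

lemma mid_lip (S : Setup h r₀ Θ) (hK : GoodK h Θ K) (hδ : δ ∈ Ioo (-1:ℝ) 1)
    (hg : IsGFamily h Θ δ g) (hΨ : IsPsi K δ g Ψ) {x₁ : ℝ} (hx : x₁ ∈ Icc (0:ℝ) 1) {σ : ℝ}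
    (hσ : σ = 1 ∨ σ = -1) (hsg : 0 < σ * (x₁ - 1 / 2)) {ε : ℝ} (hε : 0 < ε) :
    ∃ b < (1 / 2 : ℝ), ∀ y ∈ unitSq, 0 < σ * (y.1 - 1 / 2) → b < y.2 → y.2 < 1 / 2 →
      ‖Ψ y - Ψ (x₁, 1 / 2) - matL (1 - σ * δ) 0 0 1 (y - (x₁, 1 / 2))‖ ≤
        ε * ‖y - (x₁, 1 / 2)‖ := by
  obtain ⟨b, hb0, hb1, hb⟩ := S.err_small (show 0 < ε / 4 by positivity)
  have r0p := S.hr₀.1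
  set s : Set (ℝ × ℝ) := (Icc (0:ℝ) 1 ∩ {t | 0 < σ * (t - 1 / 2)}) ×ˢ Ioo b (1/2) with hs
  have conv : Convex ℝ s := by
    refine Convex.prod ((convex_Icc 0 1).inter ?_) (convex_Ioo _ _)
    rcases hσ with rfl | rfl
    · convert convex_Ioi (𝕜 := ℝ) (1 / 2 : ℝ) using 1
      ext t; simp only [mem_setOf_eq, mem_Ioi]; constructor <;> intro <;> linarith
    · convert convex_Iio (𝕜 := ℝ) (1 / 2 : ℝ) using 1
      ext t; simp only [mem_setOf_eq, mem_Iio]; constructor <;> intro <;> linarith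
  have ssub : s ⊆ unitSq := by
    rintro y ⟨⟨h1, -⟩, h2, h3⟩
    exact ⟨h1, by linarith, by linarith⟩
  have sl : ∀ y ∈ s, y ∈ lowerDom := by
    rintro y ⟨⟨h1, h4⟩, h2, h3⟩
    refine mem_lowerDom.2 ⟨h1, ⟨by linarith, h3⟩, fun hc => ?_⟩
    rw [hc] at h4; simp at h4
  have hd : ∀ y ∈ s, ∃ f' : ℝ × ℝ →L[ℝ] ℝ × ℝ, HasFDerivWithinAt Ψ f' s y ∧
      ‖f' - matL (1 - σ * δ) 0 0 1‖ ≤ ε := by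
    intro y hy
    have yl := sl y hy
    have hr := rad_mem hK yl
    have hle := le_rad S hK yl
    have hbr : b < rad K y := lt_of_lt_of_le hy.2.1 hle
    obtain ⟨-, a, b', c, d, hD, i1, i2, i3, i4⟩ :=
      low_point S hK hδ hg hΨ yl (by linarith) hσ hy.1.2
    refine ⟨_, hD.mono ssub, (matL_norm_sub_le _ _ _ _ _ _ _ _).trans ?_⟩
    have e1 := (hb _ ⟨hbr, hr.2⟩).1
    have e2 : |δ| * Setup.err h Θ (rad K y) ≤ ε / 4 := by
      have hd1 : |δ| ≤ 1 := (abs_lt.2 hδ).le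
      have := abs_nonneg δ
      nlinarith
    rw [sub_zero, sub_zero]
    linarith
  choose! f' hf1 hf2 using hd
  refine ⟨b, hb1, fun y y1 y2 y3 y4 => ?_⟩
  have ys : y ∈ s := ⟨⟨y1.1, y2⟩, y3, y4⟩
  have lip : ∀ t ∈ Ioo b (1 / 2), ‖Ψ y - Ψ (x₁, t) - matL (1 - σ * δ) 0 0 1 (y - (x₁, t))‖ ≤
      ε * ‖y - (x₁, t)‖ := fun t ht =>
    conv.norm_image_sub_le_of_norm_hasFDerivWithin_le' hf1 hf2 ⟨⟨hx, hsg⟩, ht⟩ ys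
  have T := vert_cont S hK hδ hg hΨ hx hσ hsg
  have T2 : Tendsto (fun t : ℝ => (x₁, t)) (nhdsWithin (1/2) (Iio (1/2))) (nhds (x₁, 1 / 2)) := by
    have : Continuous (fun t : ℝ => (x₁, t)) := by fun_prop
    exact (this.tendsto (1 / 2)).mono_left nhdsWithin_le_nhds
  refine le_of_tendsto_of_tendsto ((tendsto_const_nhds.sub T).sub
    (((matL (1 - σ * δ) 0 0 1).continuous.tendsto _).comp (tendsto_const_nhds.sub T2))).norm
    ((tendsto_const_nhds.sub T2).norm.const_mul ε) ?_
  filter_upwards [Ioo_mem_nhdsLT hb1] with t ht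
  exact lip t ht

lemma mid_point (S : Setup h r₀ Θ) (hK : GoodK h Θ K) (hδ : δ ∈ Ioo (-1:ℝ) 1)
    (hg : IsGFamily h Θ δ g) (hΨ : IsPsi K δ g Ψ) {x₁ : ℝ} (hx : x₁ ∈ Icc (0:ℝ) 1) {σ : ℝ}
    (hσ : σ = 1 ∨ σ = -1) (hsg : 0 < σ * (x₁ - 1 / 2)) :
    HasFDerivWithinAt Ψ (matL (1 - σ * δ) 0 0 1) unitSq (x₁, 1 / 2) := by
  rw [hasFDerivWithinAt_iff_isLittleO, Asymptotics.isLittleO_iff]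
  intro ε hε
  obtain ⟨b, hb1, hb⟩ := mid_lip S hK hδ hg hΨ hx hσ hsg hε
  have ev1 : ∀ᶠ y : ℝ × ℝ in nhds (x₁, 1 / 2), 0 < σ * (y.1 - 1 / 2) := by
    have : ContinuousAt (fun y : ℝ × ℝ => σ * (y.1 - 1 / 2)) (x₁, 1 / 2) := by fun_prop
    exact continuousAt_const.eventually_lt this hsg
  have ev2 : ∀ᶠ y : ℝ × ℝ in nhds (x₁, 1 / 2), b < y.2 :=
    continuousAt_const.eventually_lt continuous_snd.continuousAt hb1
  have ev3 : ∀ᶠ y : ℝ × ℝ in nhds (x₁, 1 / 2), y.2 < 1 - b :=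
    continuous_snd.continuousAt.eventually_lt continuousAt_const (by simp only; linarith)
  filter_upwards [mem_nhdsWithin_of_mem_nhds ev1, mem_nhdsWithin_of_mem_nhds ev2,
    mem_nhdsWithin_of_mem_nhds ev3, self_mem_nhdsWithin] with y y1 y2 y3 y4
  have y1' : 0 < σ * (y.1 - 1 / 2) := y1
  have y2' : b < y.2 := y2
  have y3' : y.2 < 1 - b := y3
  rcases lt_trichotomy y.2 (1 / 2) with h0 | h0 | h0
  · exact hb y y4 y1' y2' h0
  · obtain ⟨u, v⟩ := y
    simp only at h0
    subst h0
    rw [Psi_mid hΨ hx hσ hsg, Psi_mid hΨ y4.1 hσ y1']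
    have : ((1 / 2 + (1 - σ * δ) * (u - 1 / 2) + δ / 2, (1 / 2 : ℝ)) : ℝ × ℝ) -
        (1 / 2 + (1 - σ * δ) * (x₁ - 1 / 2) + δ / 2, 1 / 2) -
        matL (1 - σ * δ) 0 0 1 ((u, 1 / 2) - (x₁, 1 / 2)) = 0 := by
      rw [matL_apply]
      ext
      · simp; ring
      · simp
    rw [this, norm_zero]
    positivity
  · have := hb (rho y) (rho_mapsTo y4) y1' (by simp only [rho]; linarith)
      (by simp only [rho]; linarith)
    have e : Ψ y = rho (Ψ (rho y)) := hΨ.2.2.1 y y4 h0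
    have hm := congrArg Prod.snd (Psi_mid hΨ hx hσ hsg)
    simp only at hm
    have n1 : ‖rho y - (x₁, 1 / 2)‖ = ‖y - (x₁, 1 / 2)‖ := by
      rw [Prod.norm_def, Prod.norm_def]
      congr 1
      simp only [rho, Prod.snd_sub]
      rw [← norm_neg]; congr 1; ring
    have n2 : ‖Ψ (rho y) - Ψ (x₁, 1 / 2) - matL (1 - σ * δ) 0 0 1 (rho y - (x₁, 1 / 2))‖ =
        ‖Ψ y - Ψ (x₁, 1 / 2) - matL (1 - σ * δ) 0 0 1 (y - (x₁, 1 / 2))‖ := by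
      rw [e, Prod.norm_def, Prod.norm_def]
      congr 1
      · congr 1
        simp [rho, matL_apply]
      · simp only [rho, Prod.snd_sub, matL_apply, hm]
        rw [← norm_neg]; congr 1; ring
    rwa [n1, n2] at this

end


lemma unitSq_udo : UniqueDiffOn ℝ unitSq :=
  (uniqueDiffOn_Icc zero_lt_one).prod (uniqueDiffOn_Icc zero_lt_one)

lemma exists_sign {t : ℝ} (ht : t ≠ 1 / 2) :
    ∃ σ : ℝ, (σ = 1 ∨ σ = -1) ∧ 0 < σ * (t - 1 / 2) := by
  rcases lt_or_gt_of_ne ht with h | h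
  · exact ⟨-1, Or.inr rfl, by linarith⟩
  · exact ⟨1, Or.inl rfl, by linarith⟩

theorem stmt_4 (h : ℝ → ℝ) (hh : GoodH h)
    (r₀ : ℝ) (hr₀ : r₀ ∈ Set.Ioo (0:ℝ) (1/2)) (hr₀eq : 2 * r₀ * h r₀ + r₀ ^ 2 = 1/4)
    (Θ : ℝ → ℝ) (hΘ : GoodTheta h r₀ Θ)
    (K : ℝ × ℝ → ℝ × ℝ) (hK : GoodK h Θ K) :
    ∃ C₁ : ℝ, 0 < C₁ ∧
      ∀ δ ∈ Set.Ioo (-1:ℝ) 1, ∀ g : ℝ → ℝ → ℝ, ∀ Ψ : ℝ × ℝ → ℝ × ℝ,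
        IsGFamily h Θ δ g → IsPsi K δ g Ψ →
          (∀ x ∈ unitSq \ (crack ∪ seams r₀ K), DifferentiableWithinAt ℝ Ψ unitSq x) ∧
          ContinuousOn (fun x => fderivWithin ℝ Ψ unitSq x)
            (unitSq \ (crack ∪ seams r₀ K)) ∧
          (∀ x ∈ unitSq \ (crack ∪ seams r₀ K),
            |(fderivWithin ℝ Ψ unitSq x (1, 0)).1 - 1| ≤ C₁ * |δ| ∧
            |(fderivWithin ℝ Ψ unitSq x (1, 0)).2| ≤ C₁ * |δ| ∧
            |(fderivWithin ℝ Ψ unitSq x (0, 1)).1| ≤ C₁ * |δ| ∧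
            |(fderivWithin ℝ Ψ unitSq x (0, 1)).2 - 1| ≤ C₁ * |δ|) := by

  have S : Setup h r₀ Θ := ⟨hh, hr₀, hr₀eq, hΘ⟩
  obtain ⟨C, hC0, hC⟩ := S.err_bdd
  refine ⟨1 + C, by linarith, ?_⟩
  intro δ hδ g Ψ hg hΨ
  have key : ∀ x ∈ unitSq \ (crack ∪ seams r₀ K), ∀ σ : ℝ, (σ = 1 ∨ σ = -1) →
      0 < σ * (x.1 - 1 / 2) → ∃ e : ℝ, e ≤ C ∧ Good Ψ δ σ e x := by
    intro x hx σ hσ hsg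
    have hs : x ∉ seams r₀ K := fun hm => hx.2 (Or.inr hm)
    by_cases hm : x.2 = 1 / 2
    · refine ⟨0, hC0.le, 1 - σ * δ, 0, 0, 1, ?_, by simp, by simp, by simp, by simp⟩
      have := mid_point S hK hδ hg hΨ hx.1.1 hσ hsg
      rwa [← hm] at this
    · obtain ⟨r, hr, hne, -, -, hG⟩ := any_point S hK hδ hg hΨ hx.1 hs hm hσ hsg
      exact ⟨_, hC r hr hne, hG⟩
  have sgn : ∀ x ∈ unitSq \ (crack ∪ seams r₀ K), x.1 ≠ 1 / 2 :=
    fun x hx hm => hx.2 (Or.inl hm)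
  refine ⟨?_, ?_, ?_⟩
  · intro x hx
    obtain ⟨σ, hσ, hsg⟩ := exists_sign (sgn x hx)
    obtain ⟨e, -, a, b, c, d, hd, -⟩ := key x hx σ hσ hsg
    exact hd.differentiableWithinAt
  · intro x hx
    obtain ⟨σ, hσ, hsg⟩ := exists_sign (sgn x hx)
    have hs : x ∉ seams r₀ K := fun hm => hx.2 (Or.inr hm)
    by_cases hm : x.2 = 1 / 2
    · have hmid := mid_point S hK hδ hg hΨ hx.1.1 hσ hsg
      have hxe : (x.1, (1 / 2 : ℝ)) = x := by rw [← hm]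
      rw [hxe] at hmid
      have hf := hmid.fderivWithin (unitSq_udo x hx.1)
      rw [ContinuousWithinAt, Metric.tendsto_nhds]
      intro ε hε
      obtain ⟨b, -, hb, hbe⟩ := S.err_small (show 0 < ε / 8 by linarith)
      have c1 : ∀ᶠ y : ℝ × ℝ in nhds x, 0 < σ * (y.1 - 1 / 2) :=
        (by fun_prop : Continuous fun y : ℝ × ℝ => σ * (y.1 - 1 / 2)).continuousAt.eventually
          (lt_mem_nhds hsg)
      have c2 : ∀ᶠ y : ℝ × ℝ in nhds x, b < y.2 :=
        continuous_snd.continuousAt.eventually (lt_mem_nhds (by rw [hm]; exact hb))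
      have c3 : ∀ᶠ y : ℝ × ℝ in nhds x, y.2 < 1 - b :=
        continuous_snd.continuousAt.eventually (gt_mem_nhds (by rw [hm]; linarith))
      filter_upwards [c1.filter_mono nhdsWithin_le_nhds, c2.filter_mono nhdsWithin_le_nhds,
        c3.filter_mono nhdsWithin_le_nhds, self_mem_nhdsWithin] with y h1 h2 h3 hy
      rw [hf]
      by_cases hym : y.2 = 1 / 2
      · have hmy := mid_point S hK hδ hg hΨ hy.1.1 hσ h1
        have hye : (y.1, (1 / 2 : ℝ)) = y := by rw [← hym]
        rw [hye] at hmy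
        rw [hmy.fderivWithin (unitSq_udo y hy.1), dist_self]
        exact hε
      · obtain ⟨r, hr, hne, hyr, -, a, b', c, d, hd, ha, hb', hc, hd'⟩ :=
          any_point S hK hδ hg hΨ hy.1 (fun hm => hy.2 (Or.inr hm)) hym hσ h1
        have hrb : b < r := by rcases hyr with q | q <;> linarith
        have he := (hbe r ⟨hrb, hr.2⟩).1
        rw [hd.fderivWithin (unitSq_udo y hy.1), dist_eq_norm]
        refine (matL_norm_sub_le ..).trans_lt ?_
        have hd1 : |δ| ≤ 1 := (abs_lt.2 hδ).le
        have hde : |δ| * Setup.err h Θ r ≤ ε / 8 := by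
          have q1 : |δ| * Setup.err h Θ r ≤ |δ| * (ε / 8) :=
            mul_le_mul_of_nonneg_left he (abs_nonneg δ)
          have q2 : |δ| * (ε / 8) ≤ 1 * (ε / 8) :=
            mul_le_mul_of_nonneg_right hd1 (by linarith)
          linarith
        rw [sub_zero, sub_zero]
        linarith
    · obtain ⟨r, -, -, -, hcd, -⟩ := any_point S hK hδ hg hΨ hx.1 hs hm hσ hsg
      exact ((hcd.fderivWithin_right (m := 0) unitSq_udo (by norm_num)
        hx.1).continuousWithinAt).mono diff_subset
  · intro x hx
    obtain ⟨σ, hσ, hsg⟩ := exists_sign (sgn x hx)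
    obtain ⟨e, he, a, b, c, d, hd, ha, hb, hc, hd'⟩ := key x hx σ hσ hsg
    rw [hd.fderivWithin (unitSq_udo x hx.1)]
    have hde : |δ| * e ≤ C * |δ| := by
      rw [mul_comm C]; exact mul_le_mul_of_nonneg_left he (abs_nonneg δ)
    have hexp : (1 + C) * |δ| = |δ| + C * |δ| := by ring
    have hp := abs_nonneg δ
    have ha' : |a - 1| ≤ |δ| + C * |δ| := by
      have q : |σ * δ| = |δ| := by rcases hσ with q | q <;> simp [q]
      have : a - 1 = (a - (1 - σ * δ)) + -(σ * δ) := by ring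
      rw [this]
      refine (abs_add_le _ _).trans ?_
      rw [abs_neg, q]; linarith
    rw [hexp]
    simp only [matL_apply, mul_one, mul_zero, add_zero, zero_add]
    refine ⟨ha', ?_, ?_, ?_⟩ <;> linarith
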